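/- arXiv:1409.5425 — 11 statements merged into one kernel-verified Lean document; each statement's English description precedes it below -/
import Mathlib

section
/- Let D be a real symmetric positive semidefinite d×d matrix and C a real d×d matrix. Then the following are equivalent: (i) the only subspace U of ℝ^d with U ⊆ ker D and CᵀU ⊆ U is the zero subspace; (ii) there is no eigenvector of Cᵀ in the kernel of D, i.e., there exist no nonzero v ∈ ℂ^d and λ ∈ ℂ with Cᵀv = λv and Dv = 0 (matrices acting on ℂ^d via the entrywise embedding ℝ ⊆ ℂ). -/
open Matrix

lemma re_map_algebraMap_mulVec {m n : Type*} [Fintype n] (A : Matrix m n ℝ) (v : n → ℂ) :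
    (fun i => ((A.map (algebraMap ℝ ℂ)).mulVec v i).re) = A.mulVec (fun j => (v j).re) := by
  ext i
  simp [Matrix.mulVec, dotProduct]

lemma im_map_algebraMap_mulVec {m n : Type*} [Fintype n] (A : Matrix m n ℝ) (v : n → ℂ) :
    (fun i => ((A.map (algebraMap ℝ ℂ)).mulVec v i).im) = A.mulVec (fun j => (v j).im) := by
  ext i
  simp [Matrix.mulVec, dotProduct]

/-- The complexification of a real subspace, consisting of the complex vectors whose real and
imaginary parts lie in the subspace. -/
def Submodule.complexifyPi {n : Type*} (U : Submodule ℝ (n → ℝ)) : Submodule ℂ (n → ℂ) where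
  carrier := {v | (fun i => (v i).re) ∈ U ∧ (fun i => (v i).im) ∈ U}
  zero_mem' := ⟨U.zero_mem, U.zero_mem⟩
  add_mem' ha hb := ⟨U.add_mem ha.1 hb.1, U.add_mem ha.2 hb.2⟩
  smul_mem' c _ hv :=
    ⟨by simpa using! U.sub_mem (U.smul_mem c.re hv.1) (U.smul_mem c.im hv.2),
      by simpa using! U.add_mem (U.smul_mem c.re hv.2) (U.smul_mem c.im hv.1)⟩

lemma exists_eigenvector_mem_complexifyPi {n : Type*} [Fintype n] (A : Matrix n n ℝ)
    (U : Submodule ℝ (n → ℝ)) (hA : ∀ x ∈ U, A.mulVec x ∈ U) (hU : U ≠ ⊥) :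
    ∃ v ∈ U.complexifyPi, ∃ lam : ℂ, v ≠ 0 ∧
      (A.map (algebraMap ℝ ℂ)).mulVec v = lam • v := by
  obtain ⟨x, hx, hx0⟩ := U.exists_mem_ne_zero_of_ne_bot hU
  have hxW : (fun i => (x i : ℂ)) ∈ U.complexifyPi := by
    constructor
    · simpa using hx
    · exact U.zero_mem
  have hW : ∀ v ∈ U.complexifyPi,
      (A.map (algebraMap ℝ ℂ)).mulVecLin v ∈ U.complexifyPi := fun v hv =>
    ⟨by simpa only [mulVecLin_apply, re_map_algebraMap_mulVec] using hA _ hv.1,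
      by simpa only [mulVecLin_apply, im_map_algebraMap_mulVec] using hA _ hv.2⟩
  have : Nontrivial U.complexifyPi := by
    refine ⟨⟨⟨_, hxW⟩, 0, fun h => hx0 ?_⟩⟩
    ext i
    simpa using congrFun (congrArg Subtype.val h) i
  obtain ⟨lam, hlam⟩ :=
    Module.End.exists_eigenvalue ((A.map (algebraMap ℝ ℂ)).mulVecLin.restrict hW)
  obtain ⟨w, hw⟩ := hlam.exists_hasEigenvector
  exact ⟨w, w.2, lam, fun h => hw.2 (Subtype.ext h), congrArg Subtype.val hw.apply_eq_smul⟩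

/-- The span of the real and imaginary parts of an eigenvector of a real matrix is invariant. -/
lemma mulVec_mem_span_re_im {n : Type*} [Fintype n] {A : Matrix n n ℝ} {v : n → ℂ} {lam : ℂ}
    (h : (A.map (algebraMap ℝ ℂ)).mulVec v = lam • v) {x : n → ℝ}
    (hx : x ∈ Submodule.span ℝ {fun i => (v i).re, fun i => (v i).im}) :
    A.mulVec x ∈ Submodule.span ℝ {fun i => (v i).re, fun i => (v i).im} := by
  have hre : A.mulVec (fun i => (v i).re) =
      lam.re • (fun i => (v i).re) + (-lam.im) • (fun i => (v i).im) := by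
    rw [← re_map_algebraMap_mulVec, h]
    ext i
    simp [sub_eq_add_neg]
  have him : A.mulVec (fun i => (v i).im) =
      lam.im • (fun i => (v i).re) + lam.re • (fun i => (v i).im) := by
    rw [← im_map_algebraMap_mulVec, h]
    ext i
    simp [add_comm]
  obtain ⟨a, b, rfl⟩ := Submodule.mem_span_pair.1 hx
  rw [mulVec_add, mulVec_smul, mulVec_smul]
  refine Submodule.add_mem _ (Submodule.smul_mem _ _ ?_) (Submodule.smul_mem _ _ ?_)
  · exact Submodule.mem_span_pair.2 ⟨_, _, hre.symm⟩
  · exact Submodule.mem_span_pair.2 ⟨_, _, him.symm⟩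

/-- For a real symmetric positive semidefinite matrix `D` and a real matrix
`C`, the following are equivalent: (i) the only subspace of `ker D` invariant under `Cᵀ` is the
zero subspace; (ii) no (complex) eigenvector of `Cᵀ` lies in the kernel of `D`. -/
theorem hypoellipticity_equiv_no_eigenvector_in_kerD
    (d : ℕ) (hd : 1 ≤ d) (D C : Matrix (Fin d) (Fin d) ℝ) (hD : D.PosSemidef) :
    (∀ U : Submodule ℝ (Fin d → ℝ),
        U ≤ LinearMap.ker D.mulVecLin → (∀ x ∈ U, Cᵀ.mulVec x ∈ U) → U = ⊥)
      ↔
    ¬ ∃ (v : Fin d → ℂ) (lam : ℂ), v ≠ 0 ∧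
        (C.map (algebraMap ℝ ℂ))ᵀ.mulVec v = lam • v ∧
        (D.map (algebraMap ℝ ℂ)).mulVec v = 0 := by
  constructor
  · rintro hU ⟨v, lam, hv, hC, hDv⟩
    rw [← transpose_map] at hC
    have hbot := hU (Submodule.span ℝ {fun i => (v i).re, fun i => (v i).im}) ?_
      fun x hx => mulVec_mem_span_re_im hC hx
    · rw [Submodule.span_eq_bot] at hbot
      refine hv (funext fun i => Complex.ext ?_ ?_)
      · exact congrFun (hbot _ (Set.mem_insert _ _)) i
      · exact congrFun (hbot _ (Set.mem_insert_of_mem _ rfl)) i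
    · rw [Submodule.span_le, Set.pair_subset_iff]
      constructor
      · exact ((re_map_algebraMap_mulVec D v).symm.trans (by rw [hDv]; rfl) :
          D.mulVec (fun j => (v j).re) = 0)
      · exact ((im_map_algebraMap_mulVec D v).symm.trans (by rw [hDv]; rfl) :
          D.mulVec (fun j => (v j).im) = 0)
  · intro h U hUD hUC
    by_contra hU
    obtain ⟨v, hvU, lam, hv, hlam⟩ := exists_eigenvector_mem_complexifyPi Cᵀ U hUC hU
    refine h ⟨v, lam, hv, by rwa [← transpose_map], funext fun i => Complex.ext ?_ ?_⟩
    · have := (re_map_algebraMap_mulVec D v).trans (hUD hvU.1)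
      exact congrFun this i
    · have := (im_map_algebraMap_mulVec D v).trans (hUD hvU.2)
      exact congrFun this i
end

section
/- Let D be a real symmetric positive semidefinite d×d matrix of rank k with 1 ≤ k < d, and let C be a real d×d matrix. Then the following are equivalent: (i) the only subspace U of ℝ^d with U ⊆ ker D and CᵀU ⊆ U is the zero subspace; (iii) there exist a natural number τ with 1 ≤ τ ≤ d − k and a constant κ > 0 such that Σ_{j=0}^{τ} Cʲ D (Cᵀ)ʲ ≥ κ·Id, i.e., Σ_{j=0}^{τ} Cʲ D (Cᵀ)ʲ − κ·Id is positive semidefinite. -/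
open Matrix

/-- The vectors annihilated by `D * E ^ j` for all `j ≤ n`. -/
def krylovKer {d : ℕ} (D E : Matrix (Fin d) (Fin d) ℝ) (n : ℕ) : Submodule ℝ (Fin d → ℝ) where
  carrier := {x | ∀ j ≤ n, D *ᵥ (E ^ j *ᵥ x) = 0}
  add_mem' hx hy j hj := by simp [mulVec_add, hx j hj, hy j hj]
  zero_mem' j _ := by simp
  smul_mem' c x hx j hj := by simp [mulVec_smul, hx j hj]

theorem mem_krylovKer {d : ℕ} {D E : Matrix (Fin d) (Fin d) ℝ} {n : ℕ} {x : Fin d → ℝ} :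
    x ∈ krylovKer D E n ↔ ∀ j ≤ n, D *ᵥ (E ^ j *ᵥ x) = 0 := Iff.rfl

theorem krylovKer_succ_le {d : ℕ} (D E : Matrix (Fin d) (Fin d) ℝ) (n : ℕ) :
    krylovKer D E (n + 1) ≤ krylovKer D E n :=
  fun _ hx j hj => hx j (by omega)

theorem krylovKer_le_ker {d : ℕ} (D E : Matrix (Fin d) (Fin d) ℝ) (n : ℕ) :
    krylovKer D E n ≤ LinearMap.ker D.mulVecLin :=
  fun x hx => by simpa using hx 0 (Nat.zero_le n)

theorem mulVec_mem_krylovKer {d : ℕ} {D E : Matrix (Fin d) (Fin d) ℝ} {n : ℕ}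
    {x : Fin d → ℝ} (hx : x ∈ krylovKer D E (n + 1)) : E *ᵥ x ∈ krylovKer D E n := by
  intro j hj
  rw [mulVec_mulVec x, ← pow_succ]
  exact hx (j + 1) (by omega)

/-- If `ker D` contains no nonzero `E`-invariant subspace, each step of the decreasing
sequence `krylovKer D E n` lowers the dimension until it reaches zero. -/
theorem finrank_krylovKer_le {d : ℕ} {D E : Matrix (Fin d) (Fin d) ℝ}
    (h : ∀ U : Submodule ℝ (Fin d → ℝ),
      U ≤ LinearMap.ker D.mulVecLin → (∀ x ∈ U, E *ᵥ x ∈ U) → U = ⊥) (n : ℕ) :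
    Module.finrank ℝ (krylovKer D E n) ≤ (d - D.rank) - n := by
  induction n with
  | zero =>
    have h1 := Submodule.finrank_mono (krylovKer_le_ker D E 0)
    have h2 := LinearMap.finrank_range_add_finrank_ker D.mulVecLin
    have h3 : D.rank = Module.finrank ℝ (LinearMap.range D.mulVecLin) := rfl
    rw [Module.finrank_fin_fun] at h2
    omega
  | succ n ih =>
    rcases (krylovKer_succ_le D E n).eq_or_lt with heq | hlt
    · have hbot : krylovKer D E (n + 1) = ⊥ :=
        h _ (krylovKer_le_ker D E _) fun x hx => by
          have := mulVec_mem_krylovKer hx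
          rwa [← heq] at this
      rw [hbot, finrank_bot]
      exact Nat.zero_le _
    · have := Submodule.finrank_lt_finrank_of_lt hlt
      omega

theorem dotProduct_sum_conj_mulVec {d : ℕ} (D C : Matrix (Fin d) (Fin d) ℝ) (n : ℕ)
    (x : Fin d → ℝ) :
    x ⬝ᵥ ((∑ j ∈ Finset.range n, C ^ j * D * Cᵀ ^ j) *ᵥ x)
      = ∑ j ∈ Finset.range n, (Cᵀ ^ j *ᵥ x) ⬝ᵥ (D *ᵥ (Cᵀ ^ j *ᵥ x)) := by
  rw [sum_mulVec, dotProduct_sum]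
  refine Finset.sum_congr rfl fun j _ => ?_
  rw [← mulVec_mulVec, ← mulVec_mulVec, dotProduct_mulVec, ← mulVec_transpose, transpose_pow]

theorem isHermitian_sum_conj {d : ℕ} {D : Matrix (Fin d) (Fin d) ℝ} (hD : D.IsHermitian)
    (C : Matrix (Fin d) (Fin d) ℝ) (n : ℕ) :
    (∑ j ∈ Finset.range n, C ^ j * D * Cᵀ ^ j).IsHermitian := by
  have hD' : Dᵀ = D := hD
  simp [IsHermitian, transpose_sum, hD', Matrix.mul_assoc]


open Matrix

open scoped MatrixOrder Matrix.Norms.L2Operator in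
theorem Matrix.PosDef.exists_pos_smul_one_le {d : ℕ} [NeZero d] {A : Matrix (Fin d) (Fin d) ℝ}
    (hA : A.PosDef) : ∃ κ : ℝ, 0 < κ ∧ (A - κ • (1 : Matrix (Fin d) (Fin d) ℝ)).PosSemidef := by
  obtain ⟨κ, hκ, hle⟩ := (CFC.exists_pos_algebraMap_le_iff (a := A) hA.1.isSelfAdjoint).2
    fun x hx => hA.isStrictlyPositive.spectrum_pos hx
  rw [Algebra.algebraMap_eq_smul_one, Matrix.le_iff] at hle
  exact ⟨κ, hκ, hle⟩

/-- For a real symmetric positive semidefinite matrix `D` of rank `k`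
(`1 ≤ k < d`) and a real matrix `C`, the following are equivalent: (i) the only subspace of
`ker D` invariant under `Cᵀ` is the zero subspace; (iii) there exist `1 ≤ τ ≤ d - k` and
`κ > 0` such that `∑_{j=0}^{τ} Cʲ D (Cᵀ)ʲ ≥ κ·Id`. -/
theorem hypoellipticity_equiv_finite_rank_hoermander
    (d k : ℕ) (hk : 1 ≤ k) (hkd : k < d) (D C : Matrix (Fin d) (Fin d) ℝ)
    (hD : D.PosSemidef) (hrank : D.rank = k) :
    (∀ U : Submodule ℝ (Fin d → ℝ),
        U ≤ LinearMap.ker D.mulVecLin → (∀ x ∈ U, Cᵀ.mulVec x ∈ U) → U = ⊥)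
      ↔
    ∃ (τ : ℕ) (κ : ℝ), 1 ≤ τ ∧ τ ≤ d - k ∧ 0 < κ ∧
      (∑ j ∈ Finset.range (τ + 1), C ^ j * D * (Cᵀ) ^ j
        - κ • (1 : Matrix (Fin d) (Fin d) ℝ)).PosSemidef := by
  have hnonneg (x : Fin d → ℝ) : 0 ≤ x ⬝ᵥ (D *ᵥ x) := by
    simpa using hD.dotProduct_mulVec_nonneg x
  constructor
  · intro h
    have : NeZero d := ⟨by omega⟩
    have hfin := finrank_krylovKer_le h (d - k)
    have hbot : krylovKer D Cᵀ (d - k) = ⊥ := Submodule.finrank_eq_zero.1 (by omega)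
    have hpos : (∑ j ∈ Finset.range (d - k + 1), C ^ j * D * Cᵀ ^ j).PosDef := by
      refine .of_dotProduct_mulVec_pos (isHermitian_sum_conj hD.1 C _) fun x hx => ?_
      rw [star_trivial, dotProduct_sum_conj_mulVec]
      refine (Finset.sum_nonneg fun j _ => hnonneg _).lt_of_ne fun h0 => hx ?_
      rw [← Submodule.mem_bot ℝ, ← hbot]
      intro j hj
      refine (hD.dotProduct_mulVec_zero_iff _).1 ?_
      rw [star_trivial]
      exact (Finset.sum_eq_zero_iff_of_nonneg fun j _ => hnonneg _).1 h0.symm j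
        (Finset.mem_range.2 (by omega))
    obtain ⟨κ, hκ, hle⟩ := hpos.exists_pos_smul_one_le
    exact ⟨d - k, κ, by omega, le_rfl, hκ, hle⟩
  · rintro ⟨τ, κ, -, -, hκ, hle⟩ U hU hinv
    refine (Submodule.eq_bot_iff _).2 fun x hx => ?_
    have hpow (j : ℕ) : Cᵀ ^ j *ᵥ x ∈ U := by
      induction j with
      | zero => simpa using hx
      | succ j ih =>
        rw [pow_succ', ← mulVec_mulVec]
        exact hinv _ ih
    have hzero (j : ℕ) : D *ᵥ (Cᵀ ^ j *ᵥ x) = 0 := by simpa using hU (hpow j)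
    have hquad := hle.dotProduct_mulVec_nonneg x
    rw [star_trivial, sub_mulVec, dotProduct_sub, dotProduct_sum_conj_mulVec, smul_mulVec,
      one_mulVec, dotProduct_smul, smul_eq_mul] at hquad
    simp only [hzero, dotProduct_zero, Finset.sum_const_zero, zero_sub, neg_nonneg] at hquad
    have hself : 0 ≤ x ⬝ᵥ x := by simpa using dotProduct_star_self_nonneg x
    exact dotProduct_self_eq_zero.1 (le_antisymm (by nlinarith) hself)
end

section
/- Let D be a real symmetric positive semidefinite d×d matrix with D² = D, let C be a positively stable real d×d matrix, and let K be a symmetric positive semidefinite real d×d matrix solving the continuous Lyapunov equation 2D = CK + KCᵀ. Then K is invertible if and only if there exist no nonzero v ∈ ℂ^d and λ ∈ ℂ with Cᵀv = λv and Dv = 0 (matrices acting on ℂ^d via the entrywise embedding ℝ ⊆ ℂ). -/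
open Matrix

/-- A nonzero invariant subspace of a complex matrix contains an eigenvector. -/
theorem Matrix.exists_eigenvector_mem_of_invariant {n : Type*} [Fintype n]
    (A : Matrix n n ℂ) (W : Submodule ℂ (n → ℂ)) (hW : W ≠ ⊥)
    (hA : ∀ w ∈ W, A *ᵥ w ∈ W) :
    ∃ v ∈ W, ∃ lam : ℂ, v ≠ 0 ∧ A *ᵥ v = lam • v := by
  have : Nontrivial W := Submodule.nontrivial_iff_ne_bot.mpr hW
  obtain ⟨lam, hlam⟩ := Module.End.exists_eigenvalue (A.mulVecLin.restrict hA)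
  obtain ⟨v, hv⟩ := hlam.exists_hasEigenvector
  refine ⟨v, v.2, lam, fun h => hv.2 (Subtype.ext h), ?_⟩
  exact congrArg Subtype.val hv.apply_eq_smul

theorem Matrix.mem_spectrum_of_mulVec_eq_smul {n : Type*} [Fintype n] [DecidableEq n]
    {A : Matrix n n ℂ} {v : n → ℂ} {lam : ℂ} (hv : v ≠ 0) (h : A *ᵥ v = lam • v) :
    lam ∈ spectrum ℂ A := by
  rw [← Matrix.spectrum_toLin']
  exact (Module.End.hasEigenvalue_of_hasEigenvector (x := v)
    (Module.End.hasEigenvector_iff.mpr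
      ⟨Module.End.mem_eigenspace_iff.mpr (by simpa using h), hv⟩)).mem_spectrum

theorem Matrix.spectrum_transpose_eq {n : Type*} [Fintype n] [DecidableEq n]
    (A : Matrix n n ℂ) : spectrum ℂ Aᵀ = spectrum ℂ A := by
  ext lam
  rw [Matrix.mem_spectrum_iff_isRoot_charpoly, Matrix.mem_spectrum_iff_isRoot_charpoly,
    Matrix.charpoly_transpose]

open scoped ComplexOrder in
/-- The kernel of a Hermitian solution of `2 D = C K + K Cᴴ`, with `D` an orthogonal projection,
is contained in the kernel of `D`. -/
theorem Matrix.lyapunov_mulVec_eq_zero {n : Type*} [Fintype n]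
    {D C K : Matrix n n ℂ} (hD : Dᴴ = D) (hDD : D * D = D) (hK : Kᴴ = K)
    (h : (2 : ℂ) • D = C * K + K * Cᴴ) {w : n → ℂ} (hw : K *ᵥ w = 0) :
    D *ᵥ w = 0 := by
  have hwK : star w ᵥ* K = 0 := by
    rw [← hK, ← star_mulVec, hw, star_zero]
  have h2 : star w ⬝ᵥ ((2 : ℂ) • D) *ᵥ w = 0 := by
    rw [h, add_mulVec, ← mulVec_mulVec, hw, mulVec_zero, zero_add, ← mulVec_mulVec,
      dotProduct_mulVec, hwK, zero_dotProduct]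
  rw [smul_mulVec, dotProduct_smul, smul_eq_zero_iff_right two_ne_zero] at h2
  rw [← dotProduct_star_self_eq_zero, star_mulVec, hD,
    ← dotProduct_mulVec, mulVec_mulVec, hDD, h2]

/-- Let `D` be symmetric positive semidefinite with `D² = D`, `C` positively
stable, and `K` symmetric positive semidefinite solving `2D = CK + KCᵀ`. Then `K` is invertible
iff no (complex) eigenvector of `Cᵀ` lies in the kernel of `D`. -/
theorem lyapunov_solution_invertible_iff
    (d : ℕ) (hd : 1 ≤ d) (D C K : Matrix (Fin d) (Fin d) ℝ)
    (hD : D.PosSemidef) (hDproj : D * D = D)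
    (hC : ∀ lam ∈ spectrum ℂ (C.map (algebraMap ℝ ℂ)), 0 < lam.re)
    (hK : K.PosSemidef)
    (hLyap : (2 : ℝ) • D = C * K + K * Cᵀ) :
    IsUnit K ↔
      ¬ ∃ (v : Fin d → ℂ) (lam : ℂ), v ≠ 0 ∧
        (C.map (algebraMap ℝ ℂ))ᵀ.mulVec v = lam • v ∧
        (D.map (algebraMap ℝ ℂ)).mulVec v = 0 := by
  have conj_map : ∀ M : Matrix (Fin d) (Fin d) ℝ,
      (M.map (algebraMap ℝ ℂ))ᴴ = (M.map (algebraMap ℝ ℂ))ᵀ := by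
    intro M; ext i j; simp
  have herm_map : ∀ M : Matrix (Fin d) (Fin d) ℝ, M.IsHermitian →
      (M.map (algebraMap ℝ ℂ))ᴴ = M.map (algebraMap ℝ ℂ) := by
    intro M hM
    rw [conj_map, ← transpose_map, ← conjTranspose_eq_transpose_of_trivial, hM.eq]
  have hD' := herm_map D hD.isHermitian
  have hK' := herm_map K hK.isHermitian
  have hDD : D.map (algebraMap ℝ ℂ) * D.map (algebraMap ℝ ℂ) = D.map (algebraMap ℝ ℂ) := by
    rw [← Matrix.map_mul, hDproj]
  have hL : (2 : ℂ) • D.map (algebraMap ℝ ℂ) =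
      C.map (algebraMap ℝ ℂ) * K.map (algebraMap ℝ ℂ) +
        K.map (algebraMap ℝ ℂ) * (C.map (algebraMap ℝ ℂ))ᵀ := by
    rw [← transpose_map, ← Matrix.map_mul, ← Matrix.map_mul,
      ← Matrix.map_add _ (map_add (algebraMap ℝ ℂ)), ← hLyap]
    ext i j; simp
  have hunit : IsUnit K ↔ IsUnit (K.map (algebraMap ℝ ℂ)) := by
    rw [isUnit_iff_isUnit_det, isUnit_iff_isUnit_det, ← RingHom.mapMatrix_apply,
      ← RingHom.map_det, isUnit_iff_ne_zero, isUnit_iff_ne_zero, map_ne_zero]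
  rw [hunit]
  generalize D.map (algebraMap ℝ ℂ) = D at *
  generalize hCeq : C.map (algebraMap ℝ ℂ) = C' at *
  generalize K.map (algebraMap ℝ ℂ) = K at *
  constructor
  · rintro hKu ⟨v, lam, hv, hCv, hDv⟩
    have hKv : K *ᵥ v ≠ 0 := fun h =>
      hv (mulVec_injective_of_isUnit hKu (by rw [h, mulVec_zero]))
    have hCK : C' *ᵥ (K *ᵥ v) = (-lam) • (K *ᵥ v) := by
      have h := congrArg (· *ᵥ v) hL
      simp only [smul_mulVec, hDv, smul_zero, add_mulVec, ← mulVec_mulVec, hCv,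
        mulVec_smul] at h
      rw [neg_smul, eq_neg_iff_add_eq_zero, h]
    have h1 := hC _ (mem_spectrum_of_mulVec_eq_smul hKv hCK)
    have h2 := hC lam (spectrum_transpose_eq C' ▸ mem_spectrum_of_mulVec_eq_smul hv hCv)
    rw [Complex.neg_re] at h1
    linarith
  · intro hno
    by_contra hKu
    have hker : LinearMap.ker K.mulVecLin ≠ ⊥ := fun h =>
      hKu (mulVec_injective_iff_isUnit.mp (LinearMap.ker_eq_bot.mp h))
    have hDker : ∀ w, K *ᵥ w = 0 → D *ᵥ w = 0 := fun w hw =>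
      lyapunov_mulVec_eq_zero hD' hDD hK' (by rw [hL, ← hCeq, conj_map]) hw
    obtain ⟨v, hvW, lam, hv, hCv⟩ := exists_eigenvector_mem_of_invariant C'ᵀ _ hker
      (fun w hw => by
        rw [LinearMap.mem_ker, mulVecLin_apply] at hw ⊢
        have h := congrArg (· *ᵥ w) hL
        simpa [smul_mulVec, hDker w hw, add_mulVec, ← mulVec_mulVec, hw] using h.symm)
    exact hno ⟨v, lam, hv, hCv, hDker v (by simpa using hvW)⟩
end

section
/- Let D be a real symmetric positive semidefinite d×d matrix, C a real d×d matrix, and K a symmetric positive definite real d×d matrix solving the continuous Lyapunov equation 2D = CK + KCᵀ. Define f_∞ : ℝ^d → ℝ by f_∞(x) = (2π)^{−d/2} (det K)^{−1/2} exp(−xᵀK⁻¹x/2). Then f_∞ is a stationary solution of the Fokker–Planck equation with diffusion matrix D and drift Cx: for every x ∈ ℝ^d, div(D∇f_∞ + (C x) f_∞)(x) = 0, where div F(x) := Σ_{i=1}^d ∂F_i/∂x_i(x) for a differentiable vector field F : ℝ^d → ℝ^d and ∇ denotes the gradient. -/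
open Matrix

/-- The gradient of a scalar function on `ℝ^d`, as the vector of partial derivatives. -/
noncomputable def gradient' {d : ℕ} (f : (Fin d → ℝ) → ℝ) (x : Fin d → ℝ) : Fin d → ℝ :=
  fun i => fderiv ℝ f x (Pi.single i 1)

/-- The divergence of a vector field on `ℝ^d`. -/
noncomputable def diverg {d : ℕ} (F : (Fin d → ℝ) → (Fin d → ℝ)) (x : Fin d → ℝ) : ℝ :=
  ∑ i, fderiv ℝ F x (Pi.single i 1) i

/-- The non-isotropic Gaussian with covariance matrix `K`. -/
noncomputable def gaussianSteadyState {d : ℕ} (K : Matrix (Fin d) (Fin d) ℝ)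
    (x : Fin d → ℝ) : ℝ :=
  (2 * Real.pi) ^ (-(d : ℝ) / 2) * K.det ^ (-(1 : ℝ) / 2) *
    Real.exp (-(x ⬝ᵥ K⁻¹.mulVec x) / 2)

theorem hasFDerivAt_mulVec {d : ℕ} (A : Matrix (Fin d) (Fin d) ℝ) (x : Fin d → ℝ) :
    HasFDerivAt (fun y => A.mulVec y) (LinearMap.toContinuousLinearMap A.mulVecLin) x :=
  (LinearMap.toContinuousLinearMap A.mulVecLin).hasFDerivAt

/-- The derivative of a quadratic form with symmetric matrix. -/
theorem hasFDerivAt_dotProduct_mulVec {d : ℕ} {P : Matrix (Fin d) (Fin d) ℝ} (hP : P.IsSymm)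
    (x : Fin d → ℝ) :
    ∃ L : (Fin d → ℝ) →L[ℝ] ℝ, HasFDerivAt (fun y => y ⬝ᵥ P.mulVec y) L x ∧
      ∀ v, L v = 2 * (P.mulVec x ⬝ᵥ v) := by
  have key : HasFDerivAt (fun y : Fin d → ℝ => ∑ i, y i * P.mulVec y i) _ x :=
    HasFDerivAt.fun_sum fun i _ =>
      (hasFDerivAt_apply (𝕜 := ℝ) i x).mul (hasFDerivAt_pi'.1 (hasFDerivAt_mulVec P x) i)
  refine ⟨_, key, fun v => ?_⟩
  have hs : x ⬝ᵥ P.mulVec v = P.mulVec x ⬝ᵥ v := by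
    rw [dotProduct_mulVec, ← mulVec_transpose, hP.eq]
  have h : x ⬝ᵥ P.mulVec v + P.mulVec x ⬝ᵥ v = 2 * (P.mulVec x ⬝ᵥ v) := by
    rw [hs]; ring
  rw [← h]
  simp [dotProduct, Finset.sum_add_distrib]

theorem hasFDerivAt_gaussianSteadyState {d : ℕ} {K : Matrix (Fin d) (Fin d) ℝ}
    (hK : K⁻¹.IsSymm) (x : Fin d → ℝ) :
    ∃ L : (Fin d → ℝ) →L[ℝ] ℝ, HasFDerivAt (gaussianSteadyState K) L x ∧
      ∀ v, L v = -gaussianSteadyState K x * (K⁻¹.mulVec x ⬝ᵥ v) := by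
  obtain ⟨L, hL, hLv⟩ := hasFDerivAt_dotProduct_mulVec hK x
  refine ⟨_, ((hL.neg.mul_const (2 : ℝ)⁻¹).exp).const_mul
    ((2 * Real.pi) ^ (-(d : ℝ) / 2) * K.det ^ (-(1 : ℝ) / 2)), fun v => ?_⟩
  simp only [_root_.smul_apply, _root_.neg_apply, hLv, smul_eq_mul,
    gaussianSteadyState, Pi.neg_apply, div_eq_mul_inv]
  ring

theorem gradient'_gaussianSteadyState {d : ℕ} {K : Matrix (Fin d) (Fin d) ℝ}
    (hK : K⁻¹.IsSymm) (x : Fin d → ℝ) :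
    gradient' (gaussianSteadyState K) x = -gaussianSteadyState K x • K⁻¹.mulVec x := by
  obtain ⟨L, hL, hLv⟩ := hasFDerivAt_gaussianSteadyState hK x
  ext i
  simp [gradient', hL.fderiv, hLv]

/-- The product rule for the divergence of a scalar function times a linear vector field. -/
theorem diverg_smul_mulVec {d : ℕ} {g : (Fin d → ℝ) → ℝ} (A : Matrix (Fin d) (Fin d) ℝ)
    {x : Fin d → ℝ} (hg : DifferentiableAt ℝ g x) :
    diverg (fun y => g y • A.mulVec y) x = g x * A.trace + gradient' g x ⬝ᵥ A.mulVec x := by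
  have h := hg.hasFDerivAt.fun_smul (hasFDerivAt_mulVec A x)
  simp [diverg, h.fderiv, gradient', dotProduct, Matrix.trace, Finset.sum_add_distrib,
    Finset.mul_sum]

theorem trace_mul_eq_zero_of_skew {d : ℕ} {S P : Matrix (Fin d) (Fin d) ℝ} (hS : Sᵀ = -S)
    (hP : P.IsSymm) : (S * P).trace = 0 := by
  have h := trace_transpose (S * P)
  rw [transpose_mul, hS, hP.eq, mul_neg, trace_neg, trace_mul_comm] at h
  linarith

theorem dotProduct_mulVec_eq_zero_of_skew {d : ℕ} {S : Matrix (Fin d) (Fin d) ℝ}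
    (hS : Sᵀ = -S) (v : Fin d → ℝ) : v ⬝ᵥ S.mulVec v = 0 := by
  have h : v ⬝ᵥ S.mulVec v = -(v ⬝ᵥ S.mulVec v) := by
    conv_lhs => rw [dotProduct_mulVec, ← mulVec_transpose, hS, neg_mulVec, neg_dotProduct,
      dotProduct_comm]
  linarith

/-- If `K` is symmetric positive definite and solves the Lyapunov equation
`2D = CK + KCᵀ`, then the Gaussian `f_∞` is a stationary solution of the Fokker–Planck
equation with diffusion matrix `D` and drift `Cx`: `div(D∇f_∞ + (Cx) f_∞) = 0`. -/
theorem gaussian_is_steady_state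
    (d : ℕ) (hd : 1 ≤ d) (D C K : Matrix (Fin d) (Fin d) ℝ)
    (hD : D.PosSemidef) (hK : K.PosDef)
    (hLyap : (2 : ℝ) • D = C * K + K * Cᵀ) :
    ∀ x : Fin d → ℝ,
      diverg (fun y =>
          D.mulVec (gradient' (gaussianSteadyState K) y)
            + gaussianSteadyState K y • C.mulVec y) x = 0 := by
  intro x
  have hKs : K.IsSymm := by simpa using hK.isHermitian
  have hP : K⁻¹.IsSymm := by
    rw [IsSymm, transpose_nonsing_inv, hKs.eq]
  have hdet : IsUnit K.det := hK.det_pos.ne'.isUnit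
  obtain ⟨S, hS, hA⟩ : ∃ S : Matrix (Fin d) (Fin d) ℝ, Sᵀ = -S ∧ C - D * K⁻¹ = S * K⁻¹ := by
    refine ⟨C * K - D, ?_, ?_⟩
    · have hDs : Dᵀ = D := by simpa using hD.isHermitian.eq
      rw [transpose_sub, transpose_mul, hKs.eq, hDs, neg_sub, sub_eq_sub_iff_add_eq_add,
        ← two_smul ℝ D, hLyap, add_comm]
    · rw [sub_mul, mul_nonsing_inv_cancel_right _ _ hdet]
  have hF : (fun y => D.mulVec (gradient' (gaussianSteadyState K) y)
      + gaussianSteadyState K y • C.mulVec y)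
      = fun y => gaussianSteadyState K y • (S * K⁻¹).mulVec y := by
    ext1 y
    rw [gradient'_gaussianSteadyState hP, ← hA, sub_mulVec, mulVec_smul, mulVec_mulVec]
    module
  obtain ⟨L, hL, -⟩ := hasFDerivAt_gaussianSteadyState hP x
  rw [hF, diverg_smul_mulVec _ hL.differentiableAt, trace_mul_eq_zero_of_skew hS hP,
    gradient'_gaussianSteadyState hP, smul_dotProduct, ← mulVec_mulVec,
    dotProduct_mulVec_eq_zero_of_skew hS]
  simp
end

section
/- Let Q be a real d×d matrix all of whose eigenvalues (as a complex matrix) have strictly positive real part, and set μ := min{Re λ : λ is an eigenvalue of Q}. Assume that every eigenvalue λ of Q with Re λ = μ is non-defective, i.e., its geometric multiplicity equals its algebraic multiplicity. Then there exists a symmetric positive definite real d×d matrix P such that QP + PQᵀ ≥ 2μP, i.e., QP + PQᵀ − 2μP is positive semidefinite. (In the paper this is applied to Q = KCᵀK⁻¹, whose eigenvalues coincide with those of C.) -/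
open Matrix

namespace Matrix

section ShiftedLyapunov

open scoped ComplexOrder

variable {n : Type*} [Fintype n]

/-- The entrywise real part of a positive semidefinite matrix is positive semidefinite. -/
lemma PosSemidef.map_re {H : Matrix n n ℂ} (hH : H.PosSemidef) :
    (H.map Complex.re).PosSemidef := by
  refine .of_dotProduct_mulVec_nonneg ?_ fun x => ?_
  · ext i j
    have h := congrArg Complex.re (hH.isHermitian.apply i j)
    simpa using h
  · have h := (Complex.le_def.1 (hH.dotProduct_mulVec_nonneg fun i => (x i : ℂ))).1
    simpa [dotProduct, mulVec, Finset.mul_sum] using h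

/-- The operator `H ↦ A H + H Aᴴ - 2 μ H`. -/
noncomputable def shiftedLyapunov (A : Matrix n n ℂ) (μ : ℝ) (H : Matrix n n ℂ) : Matrix n n ℂ :=
  A * H + H * Aᴴ - (2 * μ) • H

lemma shiftedLyapunov_add (A : Matrix n n ℂ) (μ : ℝ) (H K : Matrix n n ℂ) :
    shiftedLyapunov A μ (H + K) = shiftedLyapunov A μ H + shiftedLyapunov A μ K := by
  simp only [shiftedLyapunov, Matrix.mul_add, Matrix.add_mul, smul_add]
  abel

lemma shiftedLyapunov_smul (A : Matrix n n ℂ) (μ r : ℝ) (H : Matrix n n ℂ) :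
    shiftedLyapunov A μ (r • H) = r • shiftedLyapunov A μ H := by
  simp only [shiftedLyapunov, Matrix.mul_smul, Matrix.smul_mul, smul_add, smul_sub,
    smul_comm r (2 * μ)]

lemma shiftedLyapunov_zero (A : Matrix n n ℂ) (μ : ℝ) : shiftedLyapunov A μ 0 = 0 := by
  simp [shiftedLyapunov]

lemma shiftedLyapunov_vecMulVec {A : Matrix n n ℂ} {lam : ℂ} {v w : n → ℂ}
    (h : A *ᵥ v = lam • v + w) (μ : ℝ) :
    shiftedLyapunov A μ (vecMulVec v (star v)) =
      (2 * (lam.re - μ)) • vecMulVec v (star v) + vecMulVec w (star v) + vecMulVec v (star w) := by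
  have h2 : star v ᵥ* Aᴴ = star (lam • v + w) := by rw [← h, star_mulVec]
  rw [shiftedLyapunov, mul_vecMulVec, vecMulVec_mul, h, h2]
  ext i j
  have h3 : lam + star lam = ((2 * lam.re : ℝ) : ℂ) := Complex.add_conj lam
  simp only [Matrix.sub_apply, Matrix.add_apply, Matrix.smul_apply, vecMulVec_apply, Pi.add_apply,
    Pi.smul_apply, Pi.star_apply, star_add, star_smul, smul_eq_mul, Complex.real_smul]
  push_cast at h3 ⊢
  linear_combination (v i * star (v j)) * h3

lemma PosSemidef.real_smul {m : Type*} {H : Matrix m m ℂ} (hH : H.PosSemidef) {r : ℝ} (hr : 0 ≤ r) :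
    (r • H).PosSemidef := hH.smul hr

/-- A generalized eigenvector `v` whose eigenvalue has real part `μ + δ > μ` is dominated by a
matrix on which the shifted Lyapunov operator is bounded below by `δ v vᴴ`. -/
lemma exists_shiftedLyapunov_of_pow {A : Matrix n n ℂ} {lam : ℂ} {μ : ℝ} (hlam : μ < lam.re)
    (k : ℕ) (v : n → ℂ)
    (hv : ((A.mulVecLin - lam • (1 : Module.End ℂ (n → ℂ))) ^ k) v = 0) :
    ∃ H : Matrix n n ℂ, H.PosSemidef ∧ (H - vecMulVec v (star v)).PosSemidef ∧
      (shiftedLyapunov A μ H - (lam.re - μ) • vecMulVec v (star v)).PosSemidef := by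
  induction k generalizing v with
  | zero =>
    obtain rfl : v = 0 := by simpa using hv
    exact ⟨0, by simp [shiftedLyapunov_zero, PosSemidef.zero]⟩
  | succ k ih =>
    obtain ⟨w, hw⟩ : ∃ w, w = (A.mulVecLin - lam • (1 : Module.End ℂ (n → ℂ))) v := ⟨_, rfl⟩
    obtain ⟨H, hH, -, hL⟩ := ih w (by rw [hw, ← Module.End.mul_apply, ← pow_succ]; exact hv)
    have hAv : A *ᵥ v = lam • v + w := by simp [hw]
    set δ := lam.re - μ with hδ
    have hδ0 : 0 < δ := by simp [hδ, hlam]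
    have hH' : ((δ⁻¹ ^ 2) • H).PosSemidef := hH.real_smul (by positivity)
    refine ⟨vecMulVec v (star v) + (δ⁻¹ ^ 2) • H,
      (posSemidef_vecMulVec_self_star v).add hH', by simpa using hH', ?_⟩
    have key : shiftedLyapunov A μ (vecMulVec v (star v) + (δ⁻¹ ^ 2) • H) -
          δ • vecMulVec v (star v) =
        (δ⁻¹ ^ 2) • (shiftedLyapunov A μ H - δ • vecMulVec w (star w)) +
          δ⁻¹ • vecMulVec (δ • v + w) (star (δ • v + w)) := by
      rw [shiftedLyapunov_add, shiftedLyapunov_smul, shiftedLyapunov_vecMulVec hAv, ← hδ]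
      ext i j
      have : (δ : ℂ) ≠ 0 := by exact_mod_cast hδ0.ne'
      simp only [Matrix.sub_apply, Matrix.add_apply, Matrix.smul_apply, vecMulVec_apply,
        Pi.add_apply, Pi.smul_apply, Pi.star_apply, star_add, star_smul, Complex.real_smul,
        star_trivial]
      push_cast
      field_simp
      ring
    rw [key]
    exact (hL.real_smul (by positivity)).add
      ((posSemidef_vecMulVec_self_star _).real_smul (by positivity))

/-- If the eigenvalues of `A` have real part at least `μ`, and those with real part `μ` are
non-defective, every rank-one matrix `v vᴴ` is dominated by some `H` with
`A H + H Aᴴ ≥ 2 μ H`. -/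
lemma exists_shiftedLyapunov_posSemidef [DecidableEq n] {A : Matrix n n ℂ} {μ : ℝ}
    (hμ : ∀ lam ∈ spectrum ℂ A, μ ≤ lam.re)
    (hnd : ∀ lam ∈ spectrum ℂ A, lam.re = μ →
      Module.finrank ℂ (LinearMap.ker (A.mulVecLin - lam • (LinearMap.id : (n → ℂ) →ₗ[ℂ] (n → ℂ))))
        = A.charpoly.rootMultiplicity lam) (v : n → ℂ) :
    ∃ H : Matrix n n ℂ, (H - vecMulVec v (star v)).PosSemidef ∧
      (shiftedLyapunov A μ H).PosSemidef := by
  have hv : v ∈ ⨆ lam : ℂ, Module.End.maxGenEigenspace A.mulVecLin lam := by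
    rw [Module.End.iSup_maxGenEigenspace_eq_top]; trivial
  refine Submodule.iSup_induction _ (motive := fun v => ∃ H : Matrix n n ℂ,
    (H - vecMulVec v (star v)).PosSemidef ∧ (shiftedLyapunov A μ H).PosSemidef) hv ?_ ?_ ?_
  · intro lam v hv
    by_cases hlam : lam ∈ spectrum ℂ A
    · rcases (hμ lam hlam).lt_or_eq with hlt | heq
      · obtain ⟨k, hk⟩ := (Module.End.mem_maxGenEigenspace _ _ _).1 hv
        obtain ⟨H, -, h1, h2⟩ := exists_shiftedLyapunov_of_pow hlt k v hk
        refine ⟨H, h1, ?_⟩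
        simpa using h2.add
          ((posSemidef_vecMulVec_self_star v).real_smul (sub_nonneg.2 hlt.le))
      · have hle : LinearMap.ker (A.mulVecLin - lam • (LinearMap.id : (n → ℂ) →ₗ[ℂ] (n → ℂ))) ≤
            Module.End.maxGenEigenspace A.mulVecLin lam := fun x hx =>
          (Module.End.mem_maxGenEigenspace _ _ _).2 ⟨1, by rw [pow_one]; exact hx⟩
        have heqs := Submodule.eq_of_le_of_finrank_eq hle (by
          rw [hnd lam hlam heq.symm, LinearMap.finrank_maxGenEigenspace_eq, charpoly_mulVecLin])
        rw [← heqs] at hv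
        have hAv : A *ᵥ v = lam • v + 0 := by
          simpa [sub_eq_zero] using hv
        refine ⟨vecMulVec v (star v), by simp [PosSemidef.zero], ?_⟩
        rw [shiftedLyapunov_vecMulVec hAv, ← heq]
        simp [PosSemidef.zero]
    · obtain ⟨k, hk⟩ := (Module.End.mem_maxGenEigenspace _ _ _).1 hv
      rw [← spectrum_toLin', spectrum.notMem_iff, IsUnit.sub_iff, Algebra.algebraMap_eq_smul_one]
        at hlam
      obtain rfl : v = 0 := by
        refine (((Module.End.isUnit_iff _).1 (hlam.pow k)).1) ?_
        rw [map_zero]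
        exact hk
      exact ⟨0, by simp [shiftedLyapunov_zero, PosSemidef.zero]⟩
  · exact ⟨0, by simp [shiftedLyapunov_zero, PosSemidef.zero]⟩
  · intro u v hu hv
    obtain ⟨H, hH, hLH⟩ := hu
    obtain ⟨K, hK, hLK⟩ := hv
    refine ⟨(2 : ℝ) • (H + K), ?_, ?_⟩
    · have key : (2 : ℝ) • (H + K) - vecMulVec (u + v) (star (u + v)) =
          (2 : ℝ) • ((H - vecMulVec u (star u)) + (K - vecMulVec v (star v))) +
            vecMulVec (u - v) (star (u - v)) := by
        ext i j
        simp only [Matrix.sub_apply, Matrix.add_apply, Matrix.smul_apply, vecMulVec_apply,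
          Pi.add_apply, Pi.sub_apply, Pi.star_apply, star_add, star_sub, Complex.real_smul]
        push_cast
        ring
      rw [key]
      exact ((hH.add hK).real_smul (by norm_num)).add (posSemidef_vecMulVec_self_star _)
    · rw [shiftedLyapunov_smul, shiftedLyapunov_add]
      exact (hLH.add hLK).real_smul (by norm_num)

/-- Real version: if the eigenvalues of `Q` have real part at least `μ`, and those with real part
`μ` are non-defective, then `Q P + P Qᵀ ≥ 2 μ P` for some positive definite `P`. -/
lemma exists_posDef_lyapunov [DecidableEq n] {Q : Matrix n n ℝ} {μ : ℝ}
    (hmin : ∀ lam ∈ spectrum ℂ (Q.map (algebraMap ℝ ℂ)), μ ≤ lam.re)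
    (hnondef : ∀ lam ∈ spectrum ℂ (Q.map (algebraMap ℝ ℂ)), lam.re = μ →
      Module.finrank ℂ
          (LinearMap.ker ((Q.map (algebraMap ℝ ℂ)).mulVecLin
            - lam • (LinearMap.id : (n → ℂ) →ₗ[ℂ] (n → ℂ))))
        = (Q.map (algebraMap ℝ ℂ)).charpoly.rootMultiplicity lam) :
    ∃ P : Matrix n n ℝ, P.PosDef ∧ (Q * P + P * Qᵀ - (2 * μ) • P).PosSemidef := by
  choose H hH hL using fun i : n =>
    exists_shiftedLyapunov_posSemidef hmin hnondef (Pi.single i 1)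
  have hone : ∑ i : n, vecMulVec (Pi.single i 1) (star (Pi.single i 1)) =
      (1 : Matrix n n ℂ) := by
    ext i j
    simp [Matrix.sum_apply, vecMulVec_apply, Pi.single_apply, Matrix.one_apply]
  have hsum : (∑ i, H i - 1).PosSemidef := by
    rw [← hone, ← Finset.sum_sub_distrib]
    exact posSemidef_sum _ fun i _ => hH i
  have hLsum : (shiftedLyapunov (Q.map (algebraMap ℝ ℂ)) μ (∑ i, H i)).PosSemidef := by
    have : shiftedLyapunov (Q.map (algebraMap ℝ ℂ)) μ (∑ i, H i) =
        ∑ i, shiftedLyapunov (Q.map (algebraMap ℝ ℂ)) μ (H i) := by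
      simp [shiftedLyapunov, Matrix.mul_sum, Matrix.sum_mul, Finset.sum_sub_distrib,
        Finset.sum_add_distrib, Finset.smul_sum]
    rw [this]
    exact posSemidef_sum _ fun i _ => hL i
  refine ⟨(∑ i, H i).map Complex.re, ?_, ?_⟩
  · have h := PosDef.one.add_posSemidef hsum.map_re
    convert h using 1
    ext i j
    by_cases hij : i = j <;> simp [hij]
  · convert hLsum.map_re using 1
    ext i j
    simp [shiftedLyapunov, Matrix.mul_apply]

end ShiftedLyapunov

end Matrix

/-- Let `Q` be a real matrix whose eigenvalues all have positive real part,
let `μ` be the minimal real part of the eigenvalues, and assume every eigenvalue with real part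
`μ` is non-defective (geometric multiplicity = algebraic multiplicity). Then there exists a
symmetric positive definite `P` with `QP + PQᵀ ≥ 2μP`. -/
theorem exists_P_nondefective
    (d : ℕ) (hd : 1 ≤ d) (Q : Matrix (Fin d) (Fin d) ℝ) (μ : ℝ)
    (hstable : ∀ lam ∈ spectrum ℂ (Q.map (algebraMap ℝ ℂ)), 0 < lam.re)
    (hμ : IsLeast {r : ℝ | ∃ lam ∈ spectrum ℂ (Q.map (algebraMap ℝ ℂ)), r = lam.re} μ)
    (hnondef : ∀ lam ∈ spectrum ℂ (Q.map (algebraMap ℝ ℂ)), lam.re = μ →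
      Module.finrank ℂ
          (LinearMap.ker ((Q.map (algebraMap ℝ ℂ)).mulVecLin
            - lam • (LinearMap.id : (Fin d → ℂ) →ₗ[ℂ] (Fin d → ℂ))))
        = (Q.map (algebraMap ℝ ℂ)).charpoly.rootMultiplicity lam) :
    ∃ P : Matrix (Fin d) (Fin d) ℝ, P.PosDef ∧
      (Q * P + P * Qᵀ - (2 * μ) • P).PosSemidef := by
  exact exists_posDef_lyapunov (fun lam h => hμ.2 ⟨lam, h, rfl⟩) hnondef
end

section
/- Let Q be a real d×d matrix all of whose eigenvalues (as a complex matrix) have strictly positive real part, and set μ := min{Re λ : λ is an eigenvalue of Q}. Assume that at least one eigenvalue λ of Q with Re λ = μ is defective, i.e., its geometric multiplicity is strictly less than its algebraic multiplicity. Then for every ε > 0 there exists a symmetric positive definite real d×d matrix P = P(ε) such that QP + PQᵀ ≥ 2(μ − ε)P, i.e., QP + PQᵀ − 2(μ−ε)P is positive semidefinite. -/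
open Matrix

open scoped Matrix.Norms.L2Operator MatrixOrder ComplexOrder in
/-- A real matrix whose complexification has operator norm at most one is a contraction. -/
theorem Matrix.posSemidef_one_sub_mul_transpose_of_norm_map_le_one {n : Type*} [Fintype n]
    [DecidableEq n] (M : Matrix n n ℝ) (hM : ‖M.map (algebraMap ℝ ℂ)‖ ≤ 1) :
    (1 - M * Mᵀ).PosSemidef := by
  set C := M.map (algebraMap ℝ ℂ) with hC
  have hle : C * star C ≤ 1 := by
    rw [← CStarAlgebra.norm_le_one_iff_of_nonneg _ (mul_star_self_nonneg C),
      CStarRing.norm_self_mul_star]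
    exact mul_le_one₀ hM (norm_nonneg _) hM
  have hmap : 1 - C * star C = (1 - M * Mᵀ).map (algebraMap ℝ ℂ) := by
    have hstar : star C = Mᵀ.map (algebraMap ℝ ℂ) := by
      ext i j
      simp [hC, star_apply]
    rw [hstar, hC, Matrix.map_sub _ (map_sub _), Matrix.map_mul,
      Matrix.map_one _ (map_zero _) (map_one _)]
  rw [Matrix.le_iff, hmap] at hle
  refine .of_dotProduct_mulVec_nonneg ?_ fun x => ?_
  · rw [IsHermitian, conjTranspose_eq_transpose_of_trivial]
    simp
  · have hx := hle.dotProduct_mulVec_nonneg (algebraMap ℝ ℂ ∘ x)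
    have hcast : star (algebraMap ℝ ℂ ∘ x) ⬝ᵥ
        ((1 - M * Mᵀ).map (algebraMap ℝ ℂ) *ᵥ (algebraMap ℝ ℂ ∘ x)) =
        ((star x ⬝ᵥ ((1 - M * Mᵀ) *ᵥ x) : ℝ) : ℂ) := by
      simp [dotProduct, mulVec]
    rw [hcast] at hx
    exact_mod_cast hx

/-- In a complex Banach algebra, some positive power of an element of spectral radius less than one
has norm at most one. -/
theorem exists_norm_pow_le_one_of_spectralRadius_lt_one {A : Type*} [NormedRing A]
    [NormedAlgebra ℂ A] [CompleteSpace A] (a : A) (ha : spectralRadius ℂ a < 1) :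
    ∃ N : ℕ, 0 < N ∧ ‖a ^ N‖ ≤ 1 := by
  have hlim := spectrum.pow_nnnorm_pow_one_div_tendsto_nhds_spectralRadius a
  obtain ⟨N, hN, hpos⟩ :=
    ((hlim.eventually_lt_const ha).and (Filter.eventually_gt_atTop 0)).exists
  refine ⟨N, hpos, ?_⟩
  by_contra! h
  have h1 : (1 : ENNReal) ≤ ‖a ^ N‖₊ := by exact_mod_cast h.le
  exact hN.not_ge (ENNReal.one_le_rpow h1 (by positivity))

open scoped Matrix.Norms.L2Operator in
/-- If the spectrum of `B` lies in a half plane `ε ≤ re`, then `1 - cB` has spectral radius less than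
one for some `c > 0`. -/
theorem Matrix.exists_spectralRadius_one_sub_smul_lt_one {n : Type*} [Fintype n] [DecidableEq n]
    [Nonempty n] (B : Matrix n n ℂ) {ε : ℝ} (hε : 0 < ε)
    (hB : ∀ w ∈ spectrum ℂ B, ε ≤ w.re) :
    ∃ c : ℝ, 0 < c ∧ spectralRadius ℂ (1 - (c : ℂ) • B) < 1 := by
  set K := ‖B‖ + 1 with hK
  have hKpos : 0 < K := by positivity
  have hc : 0 < ε / K ^ 2 := by positivity
  refine ⟨ε / K ^ 2, hc, ?_⟩
  set c := ε / K ^ 2 with hcdef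
  have hcC : (c : ℂ) ≠ 0 := by exact_mod_cast hc.ne'
  refine spectrum.spectralRadius_lt_of_forall_lt (r := 1) _ fun z hz => ?_
  obtain ⟨w, rfl⟩ : ∃ w : ℂ, z = 1 - c * w := ⟨(1 - z) / c, by field_simp; ring⟩
  have hw : w ∈ spectrum ℂ B := by
    rw [spectrum.mem_iff] at hz ⊢
    contrapose! hz
    have heq : algebraMap ℂ (Matrix n n ℂ) (1 - c * w) - (1 - (c : ℂ) • B) =
        Units.mk0 (-(c : ℂ)) (neg_ne_zero.mpr hcC) • (algebraMap ℂ (Matrix n n ℂ) w - B) := by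
      simp only [Units.smul_mk0, Algebra.algebraMap_eq_smul_one]
      module
    rw [heq]
    exact hz.smul _
  have hnorm : ‖w‖ ≤ K := (spectrum.norm_le_norm_of_mem hw).trans (by simp [hK])
  have hre := hB w hw
  have hsq : ‖1 - c * w‖ ^ 2 = 1 - 2 * c * w.re + c ^ 2 * ‖w‖ ^ 2 := by
    rw [← Complex.normSq_eq_norm_sq, ← Complex.normSq_eq_norm_sq, Complex.normSq_apply,
      Complex.normSq_apply]
    simp
    ring
  have hcK : c * K ^ 2 = ε := by rw [hcdef]; field_simp
  have hlt : ‖1 - c * w‖ ^ 2 < 1 := by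
    have h1 : ‖w‖ ^ 2 ≤ K ^ 2 := by gcongr
    have h2 : c ^ 2 * ‖w‖ ^ 2 ≤ c * ε := by
      calc c ^ 2 * ‖w‖ ^ 2 ≤ c ^ 2 * K ^ 2 := by gcongr
        _ = c * ε := by rw [← hcK]; ring
    have h3 : c * ε ≤ c * w.re := by gcongr
    have h4 : 0 < c * ε := by positivity
    linarith
  rw [← NNReal.coe_lt_coe, coe_nnnorm, NNReal.coe_one]
  exact (sq_lt_one_iff₀ (norm_nonneg _)).mp hlt

/-- If some positive power of `1 - cB` is a contraction, then `BP + PBᵀ` is positive semidefinite for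
some positive definite `P`. -/
theorem Matrix.exists_posDef_posSemidef_mul_add_mul_transpose {n : Type*} [Fintype n]
    [DecidableEq n] (B : Matrix n n ℝ) {c : ℝ} (hc : 0 < c) {N : ℕ} (hN : 0 < N)
    (hpow : (1 - (1 - c • B) ^ N * ((1 - c • B) ^ N)ᵀ).PosSemidef) :
    ∃ P : Matrix n n ℝ, P.PosDef ∧ (B * P + P * Bᵀ).PosSemidef := by
  set A := 1 - c • B with hA
  set P := ∑ k ∈ Finset.range N, A ^ k * (A ^ k)ᵀ with hP
  have hgram (M : Matrix n n ℝ) : (M * Mᵀ).PosSemidef := by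
    simpa using posSemidef_self_mul_conjTranspose M
  have hPpos : P.PosDef := by
    obtain ⟨m, rfl⟩ := Nat.exists_eq_add_one.mpr hN
    rw [hP, Finset.sum_range_succ']
    refine PosDef.posSemidef_add (posSemidef_sum _ fun k _ => hgram _) ?_
    simpa using PosDef.one
  refine ⟨P, hPpos, ?_⟩
  have htele : P - A * P * Aᵀ = 1 - A ^ N * (A ^ N)ᵀ := by
    have hAP : A * P * Aᵀ = ∑ k ∈ Finset.range N, A ^ (k + 1) * (A ^ (k + 1))ᵀ := by
      simp only [hP, Finset.mul_sum, Finset.sum_mul, pow_succ', transpose_mul, mul_assoc]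
    rw [hAP, hP, ← Finset.sum_sub_distrib,
      Finset.sum_range_sub' (fun k => A ^ k * (A ^ k)ᵀ)]
    simp
  have hexpand : B * P + P * Bᵀ = c⁻¹ • (1 - A ^ N * (A ^ N)ᵀ) + c • (B * P * Bᵀ) := by
    have h : P - A * P * Aᵀ = c • (B * P + P * Bᵀ) - c • c • (B * P * Bᵀ) := by
      rw [hA]
      simp only [transpose_sub, transpose_one, transpose_smul, sub_mul, mul_sub, one_mul, mul_one,
        smul_mul_assoc, mul_smul_comm]
      module
    rw [← htele, h, smul_sub, inv_smul_smul₀ hc.ne', inv_smul_smul₀ hc.ne', sub_add_cancel]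
  rw [hexpand]
  have hBPB : (B * P * Bᵀ).PosSemidef := by
    simpa using hPpos.posSemidef.mul_mul_conjTranspose_same B
  exact (hpow.smul (inv_pos.mpr hc).le).add (hBPB.smul hc.le)

open scoped Matrix.Norms.L2Operator in
/-- **Lyapunov's theorem**: if the complex eigenvalues of a real matrix `B` have real part at least
`ε > 0`, then `BP + PBᵀ` is positive semidefinite for some positive definite `P`. -/
theorem Matrix.exists_posDef_lyapunov_s7 {n : Type*} [Fintype n] [DecidableEq n] [Nonempty n]
    (B : Matrix n n ℝ) {ε : ℝ} (hε : 0 < ε)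
    (hspec : ∀ w ∈ spectrum ℂ (B.map (algebraMap ℝ ℂ)), ε ≤ w.re) :
    ∃ P : Matrix n n ℝ, P.PosDef ∧ (B * P + P * Bᵀ).PosSemidef := by
  obtain ⟨c, hc, hrad⟩ := Matrix.exists_spectralRadius_one_sub_smul_lt_one _ hε hspec
  obtain ⟨N, hN, hnorm⟩ := exists_norm_pow_le_one_of_spectralRadius_lt_one _ hrad
  have hA : 1 - (c : ℂ) • B.map (algebraMap ℝ ℂ) = (1 - c • B).map (algebraMap ℝ ℂ) := by
    ext i j
    by_cases hij : i = j <;> simp [hij]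
  rw [hA, ← Matrix.map_pow] at hnorm
  exact Matrix.exists_posDef_posSemidef_mul_add_mul_transpose B hc hN
    (Matrix.posSemidef_one_sub_mul_transpose_of_norm_map_le_one _ hnorm)

/-- Let `Q` be a real matrix whose eigenvalues all have positive real part,
let `μ` be the minimal real part of the eigenvalues, and assume some eigenvalue with real part
`μ` is defective (geometric multiplicity < algebraic multiplicity). Then for every `ε > 0`
there exists a symmetric positive definite `P` with `QP + PQᵀ ≥ 2(μ − ε)P`. -/
theorem exists_P_defective
    (d : ℕ) (hd : 1 ≤ d) (Q : Matrix (Fin d) (Fin d) ℝ) (μ : ℝ)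
    (hstable : ∀ lam ∈ spectrum ℂ (Q.map (algebraMap ℝ ℂ)), 0 < lam.re)
    (hμ : IsLeast {r : ℝ | ∃ lam ∈ spectrum ℂ (Q.map (algebraMap ℝ ℂ)), r = lam.re} μ)
    (hdef : ∃ lam ∈ spectrum ℂ (Q.map (algebraMap ℝ ℂ)), lam.re = μ ∧
      Module.finrank ℂ
          (LinearMap.ker ((Q.map (algebraMap ℝ ℂ)).mulVecLin
            - lam • (LinearMap.id : (Fin d → ℂ) →ₗ[ℂ] (Fin d → ℂ))))
        < (Q.map (algebraMap ℝ ℂ)).charpoly.rootMultiplicity lam) :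
    ∀ ε : ℝ, 0 < ε →
      ∃ P : Matrix (Fin d) (Fin d) ℝ, P.PosDef ∧
        (Q * P + P * Qᵀ - (2 * (μ - ε)) • P).PosSemidef := by
  intro ε hε
  have : Nonempty (Fin d) := ⟨⟨0, hd⟩⟩
  set B := Q - (μ - ε) • (1 : Matrix (Fin d) (Fin d) ℝ) with hB
  have hBmap : B.map (algebraMap ℝ ℂ) =
      Q.map (algebraMap ℝ ℂ) - algebraMap ℂ (Matrix (Fin d) (Fin d) ℂ) ((μ - ε : ℝ) : ℂ) := by
    ext i j
    by_cases hij : i = j <;> simp [hB, Matrix.algebraMap_matrix_apply, hij]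
  have hspec : ∀ w ∈ spectrum ℂ (B.map (algebraMap ℝ ℂ)), ε ≤ w.re := by
    intro w hw
    rw [hBmap, spectrum.mem_iff, ← sub_add, ← add_sub_right_comm, ← map_add,
      ← spectrum.mem_iff] at hw
    have hle := hμ.2 ⟨_, hw, rfl⟩
    simp at hle
    linarith
  obtain ⟨P, hP, hBP⟩ := Matrix.exists_posDef_lyapunov_s7 B hε hspec
  refine ⟨P, hP, ?_⟩
  have heq : Q * P + P * Qᵀ - (2 * (μ - ε)) • P = B * P + P * Bᵀ := by
    simp only [hB, sub_mul, mul_sub, transpose_sub, transpose_smul, transpose_one, smul_mul_assoc,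
      mul_smul_comm, one_mul, mul_one]
    module
  rw [heq]
  exact hBP
end

section
/- Let λ > 0 be fixed and let P be a symmetric positive definite real 2×2 matrix with entries p₁₁, p₁₂, p₂₂. For τ ∈ ℝ define P̃(τ) := N(τ)·P + P·N(τ)ᵀ + λP, where N(τ) is the 2×2 matrix with (2,1)-entry τ and all other entries 0 (so N(τ)ᵀ has (1,2)-entry τ). Then P̃(τ) is positive semidefinite if and only if |τ| ≤ (√(det P) / p₁₁) · λ. -/
open Matrix

lemma posSemidef_fin_two_iff_det_nonneg {M : Matrix (Fin 2) (Fin 2) ℝ} (hM : M.IsSymm)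
    (h₀ : 0 < M 0 0) : M.PosSemidef ↔ 0 ≤ M.det := by
  refine ⟨fun h => h.det_nonneg, fun hdet => ?_⟩
  have hsymm : M 1 0 = M 0 1 := hM.apply 0 1
  rw [det_fin_two, hsymm] at hdet
  refine PosSemidef.of_dotProduct_mulVec_nonneg (by simpa [IsHermitian] using hM.eq) fun x => ?_
  simp only [dotProduct, mulVec, Fin.sum_univ_two, Pi.star_apply, star_trivial, hsymm]
  refine nonneg_of_mul_nonneg_right ?_ h₀
  nlinarith [sq_nonneg (M 0 0 * x 0 + M 0 1 * x 1), mul_nonneg hdet (sq_nonneg (x 1))]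

/-- For fixed `λ > 0` and symmetric positive definite `P ∈ ℝ^{2×2}`, the
matrix `P̃(τ) = N(τ)P + P N(τ)ᵀ + λP` (where `N(τ)` has `(2,1)`-entry `τ` and zeros
elsewhere) is positive semidefinite iff `|τ| ≤ (√(det P)/p₁₁)·λ`. -/
theorem perturbation_posSemidef_iff
    (lam : ℝ) (hlam : 0 < lam) (P : Matrix (Fin 2) (Fin 2) ℝ) (hP : P.PosDef) (τ : ℝ) :
    (!![0, 0; τ, 0] * P + P * (!![0, 0; τ, 0])ᵀ + lam • P).PosSemidef
      ↔ |τ| ≤ Real.sqrt P.det / P 0 0 * lam := by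
  have h₀ : 0 < P 0 0 := hP.diag_pos
  have hPsymm : P.IsSymm := by simpa [IsHermitian, IsSymm] using hP.isHermitian
  have hsymm : P 1 0 = P 0 1 := hPsymm.apply 0 1
  have hdet : (!![0, 0; τ, 0] * P + P * (!![0, 0; τ, 0])ᵀ + lam • P).det
      = lam ^ 2 * P.det - (τ * P 0 0) ^ 2 := by
    simp [det_fin_two, mul_apply, vecMul, dotProduct, Fin.sum_univ_two, hsymm]
    ring
  have hsq : lam ^ 2 * P.det = (√P.det * lam) ^ 2 := by
    rw [mul_pow, Real.sq_sqrt hP.det_pos.le, mul_comm]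
  rw [posSemidef_fin_two_iff_det_nonneg, hdet, sub_nonneg, hsq, sq_le_sq, abs_mul,
    abs_of_pos h₀, abs_of_nonneg (by positivity : 0 ≤ √P.det * lam), div_mul_eq_mul_div,
    le_div_iff₀ h₀]
  · rw [IsSymm, transpose_add, transpose_add, transpose_mul, transpose_mul, transpose_smul,
      transpose_transpose, hPsymm.eq, add_comm (P * _)]
  · simpa [mul_apply, vecMul, dotProduct, Fin.sum_univ_two] using mul_pos hlam h₀
end

section
/- Let ν > 0 and ω₀ ∈ ℝ with ω₀ ≠ 0 and 4ω₀² < ν². Define the 2×2 matrices Q₀ := [[0, 1], [−ω₀², ν]] and P := [[2, ν], [ν, ν² − 2ω₀²]]. Then P is symmetric positive definite and Q₀P + PQ₀ᵀ ≥ 2κ₀·P with 2κ₀ := ν − √(ν² − 4ω₀²), i.e., Q₀P + PQ₀ᵀ − (ν − √(ν² − 4ω₀²))·P is positive semidefinite. -/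
open Matrix

/-- For `ν > 0`, `ω₀ ≠ 0` with `4ω₀² < ν²`, the matrix
`P = [[2, ν], [ν, ν² − 2ω₀²]]` is symmetric positive definite and satisfies
`Q₀P + PQ₀ᵀ ≥ (ν − √(ν² − 4ω₀²))·P` with `Q₀ = [[0, 1], [−ω₀², ν]]`. -/
theorem kinetic_matrix_estimate_overdamped
    (ν ω₀ : ℝ) (hν : 0 < ν) (hω₀ : ω₀ ≠ 0) (h : 4 * ω₀ ^ 2 < ν ^ 2) :
    (!![2, ν; ν, ν ^ 2 - 2 * ω₀ ^ 2] : Matrix (Fin 2) (Fin 2) ℝ).PosDef ∧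
    (!![0, 1; -ω₀ ^ 2, ν] * !![2, ν; ν, ν ^ 2 - 2 * ω₀ ^ 2]
        + !![2, ν; ν, ν ^ 2 - 2 * ω₀ ^ 2] * (!![0, 1; -ω₀ ^ 2, ν])ᵀ
        - (ν - Real.sqrt (ν ^ 2 - 4 * ω₀ ^ 2)) • !![2, ν; ν, ν ^ 2 - 2 * ω₀ ^ 2]).PosSemidef := by
  have hd : 0 < ν ^ 2 - 4 * ω₀ ^ 2 := by linarith
  constructor
  · refine .of_dotProduct_mulVec_pos ?_ fun x hx => ?_
    · ext i j
      fin_cases i <;> fin_cases j <;> simp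
    · have key : star x ⬝ᵥ (!![2, ν; ν, ν ^ 2 - 2 * ω₀ ^ 2] *ᵥ x) =
          ((2 * x 0 + ν * x 1) ^ 2 + (ν ^ 2 - 4 * ω₀ ^ 2) * x 1 ^ 2) / 2 := by
        simp [dotProduct, mulVec, Fin.sum_univ_two]
        ring
      rw [key]
      rcases eq_or_ne (x 1) 0 with h1 | h1
      · have h0 : x 0 ≠ 0 := fun h0 => hx <| by
          ext i
          fin_cases i <;> simp [h0, h1]
        rw [h1]
        simp only [mul_zero, add_zero]
        positivity
      · positivity
  · obtain ⟨s, hs⟩ : ∃ s, s = Real.sqrt (ν ^ 2 - 4 * ω₀ ^ 2) := ⟨_, rfl⟩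
    have hs0 : 0 ≤ s := hs ▸ Real.sqrt_nonneg _
    have hω : ω₀ ^ 2 = (ν ^ 2 - s ^ 2) / 4 := by
      rw [hs, Real.sq_sqrt hd.le]
      ring
    have key : !![0, 1; -ω₀ ^ 2, ν] * !![2, ν; ν, ν ^ 2 - 2 * ω₀ ^ 2]
        + !![2, ν; ν, ν ^ 2 - 2 * ω₀ ^ 2] * (!![0, 1; -ω₀ ^ 2, ν])ᵀ
        - (ν - s) • !![2, ν; ν, ν ^ 2 - 2 * ω₀ ^ 2] =
        (s / 2) • vecMulVec ![2, s + ν] (star ![2, s + ν]) := by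
      rw [hω]
      ext i j
      fin_cases i <;> fin_cases j <;>
        simp [vecMul, dotProduct, vecHead, vecTail] <;> ring
    rw [← hs, key]
    exact (posSemidef_vecMulVec_self_star _).smul (by positivity)
end

section
/- Let ν > 0 and ω₀ ∈ ℝ with 4ω₀² > ν². Define the 2×2 matrices Q₀ := [[0, 1], [−ω₀², ν]] and P := [[2, ν], [ν, 2ω₀²]]. Then P is symmetric positive definite and Q₀P + PQ₀ᵀ ≥ ν·P, i.e., Q₀P + PQ₀ᵀ − ν·P is positive semidefinite. -/
open Matrix

/-- For `ν > 0`, `ω₀` with `4ω₀² > ν²`, the matrix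
`P = [[2, ν], [ν, 2ω₀²]]` is symmetric positive definite and satisfies
`Q₀P + PQ₀ᵀ ≥ ν·P` with `Q₀ = [[0, 1], [−ω₀², ν]]`. -/
theorem kinetic_matrix_estimate_underdamped
    (ν ω₀ : ℝ) (hν : 0 < ν) (h : ν ^ 2 < 4 * ω₀ ^ 2) :
    (!![2, ν; ν, 2 * ω₀ ^ 2] : Matrix (Fin 2) (Fin 2) ℝ).PosDef ∧
    (!![0, 1; -ω₀ ^ 2, ν] * !![2, ν; ν, 2 * ω₀ ^ 2]
        + !![2, ν; ν, 2 * ω₀ ^ 2] * (!![0, 1; -ω₀ ^ 2, ν])ᵀ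
        - ν • !![2, ν; ν, 2 * ω₀ ^ 2]).PosSemidef := by
  refine ⟨PosDef.of_dotProduct_mulVec_pos ?_ fun x hx => ?_, ?_⟩
  · ext i j
    fin_cases i <;> fin_cases j <;> simp
  · have hquad : star x ⬝ᵥ (!![2, ν; ν, 2 * ω₀ ^ 2] *ᵥ x)
        = 2 * (x 0 + ν / 2 * x 1) ^ 2 + (4 * ω₀ ^ 2 - ν ^ 2) / 2 * x 1 ^ 2 := by
      simp [dotProduct, mulVec, Fin.sum_univ_two]
      ring
    have hdisc : 0 < 4 * ω₀ ^ 2 - ν ^ 2 := sub_pos.mpr h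
    rw [hquad]
    by_cases h1 : x 1 = 0
    · have h0 : x 0 ≠ 0 := fun h0 => hx (by ext i; fin_cases i <;> simp [h0, h1])
      rw [h1]
      simp only [mul_zero, add_zero]
      positivity
    · positivity
  · convert PosSemidef.zero (n := Fin 2) (R := ℝ) using 1
    ext i j
    rw [Matrix.sub_apply, Matrix.add_apply, Matrix.mul_apply, Matrix.mul_apply]
    fin_cases i <;> fin_cases j <;> simp [Fin.sum_univ_two] <;> ring
end

section
/- Let C̃ be a positively stable real d×d matrix and let K̃ be a symmetric positive definite real d×d matrix solving the Lyapunov equation 2·Id = C̃K̃ + K̃C̃ᵀ. Set μ := min{Re λ : λ is an eigenvalue of C̃} and let λ_K be the smallest eigenvalue of K̃⁻¹ (equivalently, the largest constant with K̃⁻¹ ≥ λ_K·Id). Then λ_K ≤ μ. -/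
open Matrix

/-- The real and imaginary parts of an eigenvector of a complexified real matrix. -/
lemma exists_real_imag_eigenvector {n : Type*} [Fintype n] [DecidableEq n]
    (C : Matrix n n ℝ) {lam : ℂ}
    (h : lam ∈ spectrum ℂ (C.map (algebraMap ℝ ℂ))) :
    ∃ a b : n → ℝ, (a ≠ 0 ∨ b ≠ 0) ∧ C *ᵥ a = lam.re • a - lam.im • b ∧
      C *ᵥ b = lam.im • a + lam.re • b := by
  rw [← Matrix.spectrum_toLin', ← Module.End.hasEigenvalue_iff_mem_spectrum] at h
  obtain ⟨v, hv⟩ := h.exists_hasEigenvector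
  have hev : C.map (algebraMap ℝ ℂ) *ᵥ v = lam • v := by simpa using hv.apply_eq_smul
  refine ⟨fun i => (v i).re, fun i => (v i).im, ?_, ?_, ?_⟩
  · by_contra! h0
    exact hv.2 (funext fun i => Complex.ext (congrFun h0.1 i) (congrFun h0.2 i))
  · ext i
    simpa [mulVec, dotProduct] using congrArg Complex.re (congrFun hev i)
  · ext i
    have := congrArg Complex.im (congrFun hev i)
    simp [mulVec, dotProduct] at this ⊢
    linarith

/-- A solution `K` of the Lyapunov equation satisfies `⟨u, C K u⟩ = ⟨u, u⟩`. -/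
lemma dotProduct_mulVec_of_lyapunov {n : Type*} [Fintype n] [DecidableEq n]
    {C K : Matrix n n ℝ} (hK : Kᵀ = K)
    (hLyap : (2 : ℝ) • (1 : Matrix n n ℝ) = C * K + K * Cᵀ) (u : n → ℝ) :
    u ⬝ᵥ (C *ᵥ (K *ᵥ u)) = u ⬝ᵥ u := by
  have h := congrArg (fun M => u ⬝ᵥ (M *ᵥ u)) hLyap
  have ht : u ⬝ᵥ ((K * Cᵀ) *ᵥ u) = u ⬝ᵥ ((C * K) *ᵥ u) := by
    rw [← hK, ← transpose_mul, mulVec_transpose, dotProduct_comm, ← dotProduct_mulVec, hK]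
  simp only [smul_mulVec, one_mulVec, add_mulVec, dotProduct_add, dotProduct_smul, ht,
    smul_eq_mul] at h
  rw [mulVec_mulVec]
  linarith

/-- If `P ≥ l` with `l ≥ 0`, then `P² ≥ l P` as quadratic forms. -/
lemma mul_dotProduct_mulVec_le {n : Type*} [Fintype n] [DecidableEq n]
    {P : Matrix n n ℝ} {l : ℝ} (hl : 0 ≤ l)
    (hP : (P - l • (1 : Matrix n n ℝ)).PosSemidef) (a : n → ℝ) :
    l * ((P *ᵥ a) ⬝ᵥ a) ≤ (P *ᵥ a) ⬝ᵥ (P *ᵥ a) := by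
  have h := hP.dotProduct_mulVec_nonneg a
  have hsq : 0 ≤ (P *ᵥ a - l • a) ⬝ᵥ (P *ᵥ a - l • a) := by
    simpa using dotProduct_star_self_nonneg (P *ᵥ a - l • a)
  simp only [star_trivial, sub_mulVec, smul_mulVec, one_mulVec, dotProduct_sub, sub_dotProduct,
    dotProduct_smul, smul_dotProduct, smul_eq_mul, dotProduct_comm a (P *ᵥ a)] at h hsq
  nlinarith [mul_nonneg hl h]

/-- Let `C̃` be positively stable and `K̃` symmetric positive definite
solving `2·Id = C̃K̃ + K̃C̃ᵀ`. Let `μ` be the minimal real part of the eigenvalues of `C̃` and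
`λ_K` the smallest eigenvalue of `K̃⁻¹` (the largest constant with `K̃⁻¹ ≥ λ_K·Id`).
Then `λ_K ≤ μ`. -/
theorem bakryEmery_rate_le_spectral_rate
    (d : ℕ) (hd : 1 ≤ d) (Ct Kt : Matrix (Fin d) (Fin d) ℝ)
    (hC : ∀ lam ∈ spectrum ℂ (Ct.map (algebraMap ℝ ℂ)), 0 < lam.re)
    (hK : Kt.PosDef)
    (hLyap : (2 : ℝ) • (1 : Matrix (Fin d) (Fin d) ℝ) = Ct * Kt + Kt * Ctᵀ)
    (μ lamK : ℝ)
    (hμ : IsLeast {r : ℝ | ∃ lam ∈ spectrum ℂ (Ct.map (algebraMap ℝ ℂ)), r = lam.re} μ)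
    (hlamK : IsGreatest {r : ℝ | (Kt⁻¹ - r • (1 : Matrix (Fin d) (Fin d) ℝ)).PosSemidef} lamK) :
    lamK ≤ μ := by
  obtain ⟨⟨lam, hlam, rfl⟩, -⟩ := hμ
  have hpos := hC lam hlam
  rcases le_total lamK 0 with hneg | hnn
  · exact hneg.trans hpos.le
  obtain ⟨a, b, hab, ha, hb⟩ := exists_real_imag_eigenvector Ct hlam
  have hKt : Ktᵀ = Kt := by simpa using hK.isHermitian.eq
  have hPt : (Kt⁻¹)ᵀ = Kt⁻¹ := by rw [transpose_nonsing_inv, hKt]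
  have hdet : IsUnit Kt.det := hK.det_pos.ne'.isUnit
  have hcancel (x : Fin d → ℝ) : Kt *ᵥ (Kt⁻¹ *ᵥ x) = x := by
    rw [mulVec_mulVec, mul_nonsing_inv _ hdet, one_mulVec]
  have ea := dotProduct_mulVec_of_lyapunov hKt hLyap (Kt⁻¹ *ᵥ a)
  have eb := dotProduct_mulVec_of_lyapunov hKt hLyap (Kt⁻¹ *ᵥ b)
  have la := mul_dotProduct_mulVec_le hnn hlamK.1 a
  have lb := mul_dotProduct_mulVec_le hnn hlamK.1 b
  have hsymm : (Kt⁻¹ *ᵥ a) ⬝ᵥ b = (Kt⁻¹ *ᵥ b) ⬝ᵥ a := by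
    rw [dotProduct_comm, dotProduct_mulVec, ← mulVec_transpose, hPt]
  rw [hcancel, ha] at ea
  rw [hcancel, hb] at eb
  simp only [dotProduct_add, dotProduct_sub, dotProduct_smul, smul_eq_mul] at ea eb
  have hq : 0 < (Kt⁻¹ *ᵥ a) ⬝ᵥ a + (Kt⁻¹ *ᵥ b) ⬝ᵥ b := by
    have hnonneg (x : Fin d → ℝ) : 0 ≤ (Kt⁻¹ *ᵥ x) ⬝ᵥ x := by
      simpa [dotProduct_comm] using hK.inv.posSemidef.dotProduct_mulVec_nonneg x
    have hstrict (x : Fin d → ℝ) (hx : x ≠ 0) : 0 < (Kt⁻¹ *ᵥ x) ⬝ᵥ x := by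
      simpa [dotProduct_comm] using hK.inv.dotProduct_mulVec_pos hx
    rcases hab with h | h
    · exact add_pos_of_pos_of_nonneg (hstrict a h) (hnonneg b)
    · exact add_pos_of_nonneg_of_pos (hnonneg a) (hstrict b h)
  rw [hsymm] at ea
  refine le_of_mul_le_mul_right ?_ hq
  linarith
end

section
/- Let C̃ be a positively stable real d×d matrix and let K̃ be a symmetric positive definite real d×d matrix solving the Lyapunov equation 2·Id = C̃K̃ + K̃C̃ᵀ. Set μ := min{Re λ : λ is an eigenvalue of C̃} and let λ_K be the smallest eigenvalue of K̃⁻¹. Assume C̃ (as a complex matrix) is diagonalizable, i.e., there exist an invertible matrix Ã ∈ ℂ^{d×d} and a diagonal matrix Λ ∈ ℂ^{d×d} with C̃ = ÃΛÃ⁻¹. Then μ ≤ κ(Ã)² · λ_K, where κ(Ã) := ‖Ã‖₂·‖Ã⁻¹‖₂ is the condition number of Ã with respect to the spectral norm ‖·‖₂ (the operator norm induced by the Euclidean norm on ℂ^d). -/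
open Matrix

/-- The spectral norm (operator 2-norm) of a complex square matrix. -/
noncomputable def spectralNorm' {d : ℕ} (A : Matrix (Fin d) (Fin d) ℂ) : ℝ :=
  ‖Matrix.toEuclideanCLM (𝕜 := ℂ) (n := Fin d) A‖

open scoped ComplexOrder

/-- A Hermitian matrix all of whose eigenvalues are at least `r` dominates `r • 1`. -/
theorem Matrix.IsHermitian.posSemidef_sub_smul_one {𝕜 n : Type*} [RCLike 𝕜] [Fintype n]
    [DecidableEq n] {H : Matrix n n 𝕜} (hH : H.IsHermitian) {r : ℝ}
    (h : ∀ (t : ℝ) (v : n → 𝕜), v ≠ 0 → H *ᵥ v = (t : 𝕜) • v → r ≤ t) :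
    (H - (r : 𝕜) • (1 : Matrix n n 𝕜)).PosSemidef := by
  have hS : (H - (r : 𝕜) • (1 : Matrix n n 𝕜)).IsHermitian := by
    simp [Matrix.IsHermitian, hH.eq]
  refine hS.posSemidef_iff_eigenvalues_nonneg.2 fun i => ?_
  have hv := hS.mulVec_eigenvectorBasis i
  have hne : ((hS.eigenvectorBasis i : EuclideanSpace 𝕜 n) : n → 𝕜) ≠ 0 := by
    intro h0
    apply hS.eigenvectorBasis.orthonormal.ne_zero i
    ext j
    exact congrFun h0 j
  have := h (hS.eigenvalues i + r) _ hne (by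
    rw [Matrix.sub_mulVec, Matrix.smul_mulVec, Matrix.one_mulVec, sub_eq_iff_eq_add] at hv
    rw [hv, RCLike.ofReal_add, add_smul, RCLike.real_smul_eq_coe_smul (K := 𝕜)])
  simpa using this

theorem re_star_dotProduct_self {d : ℕ} (v : Fin d → ℂ) :
    (star v ⬝ᵥ v).re = ‖WithLp.toLp 2 v‖ ^ 2 := by
  rw [EuclideanSpace.norm_sq_eq, dotProduct, Complex.re_sum]
  refine Finset.sum_congr rfl fun i _ => ?_
  simp [← Complex.normSq_eq_norm_sq, Complex.normSq_apply]

theorem norm_mulVec_le_spectralNorm' {d : ℕ} (B : Matrix (Fin d) (Fin d) ℂ) (v : Fin d → ℂ) :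
    ‖WithLp.toLp 2 (B *ᵥ v)‖ ≤ spectralNorm' B * ‖WithLp.toLp 2 v‖ := by
  simpa [spectralNorm'] using
    (Matrix.toEuclideanCLM (𝕜 := ℂ) (n := Fin d) B).le_opNorm (WithLp.toLp 2 v)

theorem spectralNorm'_conjTranspose {d : ℕ} (B : Matrix (Fin d) (Fin d) ℂ) :
    spectralNorm' Bᴴ = spectralNorm' B := by
  rw [spectralNorm', ← Matrix.star_eq_conjTranspose, map_star,
    ContinuousLinearMap.star_eq_adjoint, LinearIsometryEquiv.norm_map, spectralNorm']

/-- `‖Bᴴ v‖²` as the quadratic form of `B Bᴴ`. -/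
theorem re_star_dotProduct_mul_conjTranspose {d : ℕ} (B : Matrix (Fin d) (Fin d) ℂ)
    (v : Fin d → ℂ) :
    (star v ⬝ᵥ (B * Bᴴ) *ᵥ v).re = ‖WithLp.toLp 2 (Bᴴ *ᵥ v)‖ ^ 2 := by
  rw [← re_star_dotProduct_self, star_mulVec, conjTranspose_conjTranspose, ← mulVec_mulVec,
    dotProduct_mulVec]

/-- If `Λ = diag λ` with `Re λᵢ ≥ μ > 0` and `ΛM + MΛᴴ = 2BBᴴ`, then the eigenvalues of the
Hermitian matrix `M` are at most `‖B‖² / μ`. -/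
theorem eigenvalue_le_of_diagonal_lyapunov {d : ℕ} {l : Fin d → ℂ}
    {M B : Matrix (Fin d) (Fin d) ℂ} (hM : M.IsHermitian) {μ : ℝ} (hμ : 0 < μ)
    (hl : ∀ i, μ ≤ (l i).re)
    (h : diagonal l * M + M * (diagonal l)ᴴ = (2 : ℂ) • (B * Bᴴ))
    {m : ℝ} {v : Fin d → ℂ} (hv : v ≠ 0) (hmv : M *ᵥ v = (m : ℂ) • v) :
    m ≤ spectralNorm' B ^ 2 / μ := by
  have hpos : 0 < ‖WithLp.toLp 2 v‖ ^ 2 := by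
    have : WithLp.toLp 2 v ≠ 0 := fun h0 => hv (by simpa using h0)
    positivity
  rcases le_or_gt m 0 with hm | hm
  · exact hm.trans (by positivity)
  have hvM : star v ᵥ* M = (m : ℂ) • star v := by
    rw [← hM.eq, ← star_mulVec, hmv]
    ext; simp
  have key := congrArg (fun X => (star v ⬝ᵥ X *ᵥ v).re) h
  simp only [add_mulVec, ← mulVec_mulVec, dotProduct_add, hmv, smul_mulVec, mulVec_smul,
    dotProduct_smul] at key
  rw [dotProduct_mulVec _ M, hvM, smul_dotProduct, mulVec_mulVec] at key
  have hsum : (star v ⬝ᵥ diagonal l *ᵥ v + star v ⬝ᵥ (diagonal l)ᴴ *ᵥ v).re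
      = 2 * ∑ i, (l i).re * ‖v i‖ ^ 2 := by
    rw [dotProduct, dotProduct, ← Finset.sum_add_distrib, Complex.re_sum, Finset.mul_sum]
    refine Finset.sum_congr rfl fun i _ => ?_
    simp [diagonal_conjTranspose, mulVec_diagonal, ← Complex.normSq_eq_norm_sq,
      Complex.normSq_apply]
    ring
  rw [← smul_add, smul_eq_mul, Complex.re_ofReal_mul, hsum, smul_eq_mul,
    show (2 : ℂ) = ((2 : ℝ) : ℂ) by simp, Complex.re_ofReal_mul,
    re_star_dotProduct_mul_conjTranspose] at key
  have hlow : μ * ‖WithLp.toLp 2 v‖ ^ 2 ≤ ∑ i, (l i).re * ‖v i‖ ^ 2 := by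
    rw [EuclideanSpace.norm_sq_eq, Finset.mul_sum]
    exact Finset.sum_le_sum fun i _ => mul_le_mul_of_nonneg_right (hl i) (by positivity)
  have hup : ‖WithLp.toLp 2 (Bᴴ *ᵥ v)‖ ^ 2 ≤ spectralNorm' B ^ 2 * ‖WithLp.toLp 2 v‖ ^ 2 := by
    rw [← mul_pow, ← spectralNorm'_conjTranspose B]
    exact pow_le_pow_left₀ (norm_nonneg _) (norm_mulVec_le_spectralNorm' _ _) 2
  rw [le_div_iff₀ hμ]
  refine le_of_mul_le_mul_right ?_ hpos
  nlinarith [mul_le_mul_of_nonneg_left hlow hm.le]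

/-- A Hermitian solution `K` of `CK + KCᴴ = 2` with `C = A (diag λ) A⁻¹` and `Re λᵢ ≥ μ > 0`
satisfies `K ≤ κ(A)² / μ`. -/
theorem quadraticForm_le_of_lyapunov {d : ℕ} {l : Fin d → ℂ}
    {C K A : Matrix (Fin d) (Fin d) ℂ} (hK : K.IsHermitian) (hA : IsUnit A)
    (hC : C = A * diagonal l * A⁻¹) {μ : ℝ} (hμ : 0 < μ) (hl : ∀ i, μ ≤ (l i).re)
    (h : (2 : ℂ) • (1 : Matrix (Fin d) (Fin d) ℂ) = C * K + K * Cᴴ) (x : Fin d → ℂ) :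
    (star x ⬝ᵥ K *ᵥ x).re ≤
      (spectralNorm' A * spectralNorm' A⁻¹) ^ 2 / μ * ‖WithLp.toLp 2 x‖ ^ 2 := by
  have hdet := (Matrix.isUnit_iff_isUnit_det A).1 hA
  have h1 : A⁻¹ * A = 1 := nonsing_inv_mul A hdet
  have h2 : A * A⁻¹ = 1 := mul_nonsing_inv A hdet
  have h3 : Aᴴ * A⁻¹ᴴ = 1 := by rw [← conjTranspose_mul, h1, conjTranspose_one]
  have h4 : A⁻¹ᴴ * Aᴴ = 1 := by rw [← conjTranspose_mul, h2, conjTranspose_one]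
  have hM : (A⁻¹ * K * A⁻¹ᴴ).IsHermitian := isHermitian_mul_mul_conjTranspose _ hK
  have hlyap : diagonal l * (A⁻¹ * K * A⁻¹ᴴ) + (A⁻¹ * K * A⁻¹ᴴ) * (diagonal l)ᴴ
      = (2 : ℂ) • (A⁻¹ * A⁻¹ᴴ) := by
    have e := congrArg (fun X => A⁻¹ * X * A⁻¹ᴴ) h
    simp only [hC, conjTranspose_mul, mul_add, add_mul, Matrix.mul_smul,
      Matrix.smul_mul, Matrix.mul_one] at e
    rw [e]
    congr 1
    · calc _ = 1 * diagonal l * (A⁻¹ * K * A⁻¹ᴴ) := by rw [one_mul]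
        _ = _ := by rw [← h1]; simp only [mul_assoc]
    · calc _ = (A⁻¹ * K * A⁻¹ᴴ) * (diagonal l)ᴴ * 1 := by rw [mul_one]
        _ = _ := by rw [← h3]; simp only [mul_assoc]
  set b := spectralNorm' A⁻¹ ^ 2 / μ with hb
  have hps := hM.neg.posSemidef_sub_smul_one (r := -b) fun t v hv htv => by
    have := eigenvalue_le_of_diagonal_lyapunov hM hμ hl hlyap (m := -t) hv (by
      rw [neg_mulVec, neg_eq_iff_eq_neg] at htv
      rw [htv]; simp)
    linarith
  have hx := hps.re_dotProduct_nonneg (Aᴴ *ᵥ x)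
  have hKx : star (Aᴴ *ᵥ x) ⬝ᵥ (A⁻¹ * K * A⁻¹ᴴ) *ᵥ (Aᴴ *ᵥ x) = star x ⬝ᵥ K *ᵥ x := by
    rw [star_mulVec, conjTranspose_conjTranspose, ← dotProduct_mulVec, mulVec_mulVec,
      mulVec_mulVec]
    congr 2
    calc A * (A⁻¹ * K * A⁻¹ᴴ) * Aᴴ = (A * A⁻¹) * K * (A⁻¹ᴴ * Aᴴ) := by simp only [mul_assoc]
      _ = K := by rw [h2, h4, one_mul, mul_one]
  rw [sub_mulVec, neg_mulVec, smul_mulVec, one_mulVec, dotProduct_sub, dotProduct_neg, hKx,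
    dotProduct_smul, smul_eq_mul] at hx
  have hup : ‖WithLp.toLp 2 (Aᴴ *ᵥ x)‖ ^ 2 ≤ spectralNorm' A ^ 2 * ‖WithLp.toLp 2 x‖ ^ 2 := by
    rw [← mul_pow, ← spectralNorm'_conjTranspose A]
    exact pow_le_pow_left₀ (norm_nonneg _) (norm_mulVec_le_spectralNorm' _ _) 2
  have hb0 : 0 ≤ b := by positivity
  have hmul := mul_le_mul_of_nonneg_left hup hb0
  have hcalc : (spectralNorm' A * spectralNorm' A⁻¹) ^ 2 / μ * ‖WithLp.toLp 2 x‖ ^ 2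
      = b * (spectralNorm' A ^ 2 * ‖WithLp.toLp 2 x‖ ^ 2) := by
    rw [hb]; ring
  rw [hcalc]
  have hx' : 0 ≤ -(star x ⬝ᵥ K *ᵥ x).re + b * ‖WithLp.toLp 2 (Aᴴ *ᵥ x)‖ ^ 2 := by
    simpa [re_star_dotProduct_self] using hx
  linarith

/-- Let `C̃` be positively stable and `K̃` symmetric positive definite
solving `2·Id = C̃K̃ + K̃C̃ᵀ`; let `μ` be the minimal real part of the eigenvalues of `C̃` and
`λ_K` the smallest eigenvalue of `K̃⁻¹`. If `C̃` is diagonalizable over `ℂ`, say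
`C̃ = ÃΛÃ⁻¹`, then `μ ≤ κ(Ã)²·λ_K` with `κ(Ã) = ‖Ã‖₂‖Ã⁻¹‖₂`. -/
theorem spectral_rate_le_conditioned_bakryEmery_rate
    (d : ℕ) (hd : 1 ≤ d) (Ct Kt : Matrix (Fin d) (Fin d) ℝ)
    (hC : ∀ lam ∈ spectrum ℂ (Ct.map (algebraMap ℝ ℂ)), 0 < lam.re)
    (hK : Kt.PosDef)
    (hLyap : (2 : ℝ) • (1 : Matrix (Fin d) (Fin d) ℝ) = Ct * Kt + Kt * Ctᵀ)
    (μ lamK : ℝ)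
    (hμ : IsLeast {r : ℝ | ∃ lam ∈ spectrum ℂ (Ct.map (algebraMap ℝ ℂ)), r = lam.re} μ)
    (hlamK : IsGreatest {r : ℝ | (Kt⁻¹ - r • (1 : Matrix (Fin d) (Fin d) ℝ)).PosSemidef} lamK)
    (At Λ : Matrix (Fin d) (Fin d) ℂ) (hAt : IsUnit At) (hΛ : Λ.IsDiag)
    (hdiag : Ct.map (algebraMap ℝ ℂ) = At * Λ * At⁻¹) :
    μ ≤ (spectralNorm' At * spectralNorm' At⁻¹) ^ 2 * lamK := by
  obtain ⟨l, rfl⟩ : ∃ l, Λ = diagonal l := ⟨Λ.diag, hΛ.diagonal_diag.symm⟩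
  obtain ⟨lam, hlam, rfl⟩ := hμ.1
  have hμ0 := hC lam hlam
  have hspec : ∀ i, l i ∈ spectrum ℂ (Ct.map (algebraMap ℝ ℂ)) := fun i => by
    obtain ⟨u, rfl⟩ := hAt
    rw [hdiag, ← Matrix.coe_units_inv, spectrum.units_conjugate, spectrum_diagonal]
    exact ⟨i, rfl⟩
  have hl : ∀ i, lam.re ≤ (l i).re := fun i => hμ.2 ⟨l i, hspec i, rfl⟩
  have hconj : ∀ X : Matrix (Fin d) (Fin d) ℝ,
      (X.map (algebraMap ℝ ℂ))ᴴ = Xᵀ.map (algebraMap ℝ ℂ) := fun X => by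
    ext i j; simp
  have hKH : (Kt.map (algebraMap ℝ ℂ)).IsHermitian := by
    rw [Matrix.IsHermitian, hconj, ← conjTranspose_eq_transpose_of_trivial, hK.isHermitian.eq]
  have hLc : (2 : ℂ) • (1 : Matrix (Fin d) (Fin d) ℂ) = Ct.map (algebraMap ℝ ℂ) *
      Kt.map (algebraMap ℝ ℂ) + Kt.map (algebraMap ℝ ℂ) * (Ct.map (algebraMap ℝ ℂ))ᴴ := by
    rw [hconj, ← Matrix.map_mul, ← Matrix.map_mul, ← Matrix.map_add _ (map_add _), ← hLyap]
    ext i j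
    simp [Matrix.one_apply, apply_ite]
  have hform := quadraticForm_le_of_lyapunov hKH hAt hdiag hμ0 hl hLc
  set κ := (spectralNorm' At * spectralNorm' At⁻¹) ^ 2
  have hκ0 : 0 ≤ κ := by positivity
  have hKdet := (Matrix.isUnit_iff_isUnit_det Kt).1 hK.isUnit
  have heig : ∀ (t : ℝ) (v : Fin d → ℝ), v ≠ 0 → Kt⁻¹ *ᵥ v = t • v → lam.re ≤ κ * t := by
    intro t v hv htv
    have hvv : 0 < v ⬝ᵥ v := by simpa using dotProduct_star_self_pos_iff.2 hv
    have ht : 0 < t := by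
      have := hK.inv.dotProduct_mulVec_pos hv
      rw [htv, dotProduct_smul, smul_eq_mul, star_trivial] at this
      exact pos_of_mul_pos_left this hvv.le
    have hKv : t * (v ⬝ᵥ Kt *ᵥ v) = v ⬝ᵥ v := by
      rw [← smul_eq_mul, ← dotProduct_smul, ← mulVec_smul, ← htv, mulVec_mulVec,
        mul_nonsing_inv _ hKdet, one_mulVec]
    have hx := hform (fun i => (v i : ℂ))
    have hre : (star (fun i => (v i : ℂ)) ⬝ᵥ Kt.map (algebraMap ℝ ℂ) *ᵥ fun i => (v i : ℂ)).re
        = v ⬝ᵥ Kt *ᵥ v := by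
      simp [dotProduct, mulVec, Complex.re_sum]
    have hnorm : ‖WithLp.toLp 2 (fun i => (v i : ℂ))‖ ^ 2 = v ⬝ᵥ v := by
      rw [EuclideanSpace.norm_sq_eq]
      simp [dotProduct, sq]
    rw [hre, hnorm, div_mul_eq_mul_div, le_div_iff₀ hμ0] at hx
    refine le_of_mul_le_mul_right ?_ hvv
    nlinarith [mul_le_mul_of_nonneg_left hx ht.le]
  have hκpos : 0 < κ := by
    refine hκ0.lt_of_ne fun h0 => ?_
    have hi : Kt⁻¹.IsHermitian := hK.inv.isHermitian
    have := heig _ _ (fun h' => hi.eigenvectorBasis.orthonormal.ne_zero ⟨0, hd⟩ (by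
      ext j; exact congrFun h' j)) (hi.mulVec_eigenvectorBasis ⟨0, hd⟩)
    rw [← h0, zero_mul] at this
    exact hμ0.not_ge this
  have hmem := hK.inv.isHermitian.posSemidef_sub_smul_one (r := lam.re / κ) fun t v hv htv => by
    rw [div_le_iff₀' hκpos]
    exact heig t v hv htv
  have hle : lam.re / κ ≤ lamK := hlamK.2 hmem
  rwa [div_le_iff₀' hκpos] at hle
end
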